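/- arXiv:1408.4184 — 8 statements merged into one kernel-verified Lean document; each statement's English description precedes it below -/
import Mathlib

section
/- Let G = (V, E) be a directed graph whose underlying undirected graph is connected, with distinguished node v₀, and let c : E → ℝ. Then any two extreme points of the dual network flow polyhedron P(G,c) are joined by an edge walk of length at most min((|V| − 1)·|E|, |V|³/6); that is, the combinatorial diameter of P(G,c) is bounded above by min((|V| − 1)·|E|, |V|³/6). -/
open scoped BigOperators

section DualNetworkFlow

variable {V : Type*}

/-- Adjacency in the underlying undirected graph of the directed edge set `E`. -/
def UAdj (E : Set (V × V)) (a b : V) : Prop := (a, b) ∈ E ∨ (b, a) ∈ E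

/-- The underlying undirected graph of `E` is connected. -/
def UConnected (E : Set (V × V)) : Prop :=
  ∀ a b : V, Relation.ReflTransGen (UAdj E) a b

/-- A node set `S` is connected in the underlying undirected graph of `E`:
any two of its nodes are joined by a path inside `S`. -/
def SetConnected (E : Set (V × V)) (S : Set V) : Prop :=
  ∀ a ∈ S, ∀ b ∈ S, Relation.ReflTransGen (fun x y => x ∈ S ∧ y ∈ S ∧ UAdj E x y) a b

/-- The dual network flow polyhedron
`P(G,c) = { u : V → ℝ | u v₀ = 0, -u a + u b ≤ c (a,b) for all (a,b) ∈ E }`. -/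
def dualPoly (E : Set (V × V)) (v₀ : V) (c : V × V → ℝ) : Set (V → ℝ) :=
  {u | u v₀ = 0 ∧ ∀ e ∈ E, -u e.1 + u e.2 ≤ c e}

/-- An edge walk in the polyhedron `P`: a sequence of extreme points in which each pair of
consecutive points is distinct and spans a segment that is an extreme subset of `P`. -/
def IsEdgeWalk (P : Set (V → ℝ)) {k : ℕ} (w : Fin (k + 1) → V → ℝ) : Prop :=
  (∀ i, w i ∈ P.extremePoints ℝ) ∧
  ∀ i : Fin k, w i.castSucc ≠ w i.succ ∧ IsExtreme ℝ P (segment ℝ (w i.castSucc) (w i.succ))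

/-- A circuit of a dual network flow polyhedron: `±` the indicator vector of a set `S` such that
both `S` and its complement are nonempty and connected in the underlying undirected graph. -/
def IsCircuit (E : Set (V × V)) (g : V → ℝ) : Prop :=
  ∃ S : Set V, S.Nonempty ∧ Sᶜ.Nonempty ∧ SetConnected E S ∧ SetConnected E Sᶜ ∧
    (g = S.indicator 1 ∨ g = -S.indicator 1)

/-- A circuit walk in `P`: each step moves along a circuit direction by a maximal step length. -/
def IsCircuitWalk (E : Set (V × V)) (P : Set (V → ℝ)) {k : ℕ}
    (w : Fin (k + 1) → V → ℝ) : Prop :=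
  (∀ i, w i ∈ P) ∧
  ∀ i : Fin k, ∃ (g : V → ℝ) (α : ℝ), IsCircuit E g ∧ 0 < α ∧
    w i.succ = w i.castSucc + α • g ∧ ∀ β : ℝ, α < β → w i.castSucc + β • g ∉ P

/-- The combinatorial distance between two points: minimum length of an edge walk joining them. -/
noncomputable def combDist (P : Set (V → ℝ)) (u v : V → ℝ) : ℕ :=
  sInf {n | ∃ w : Fin (n + 1) → V → ℝ, IsEdgeWalk P w ∧ w 0 = u ∧ w (Fin.last n) = v}

/-- The combinatorial diameter of `P`: maximum combinatorial distance between extreme points. -/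
noncomputable def combDiam (P : Set (V → ℝ)) : ℕ :=
  sSup {d | ∃ u ∈ P.extremePoints ℝ, ∃ v ∈ P.extremePoints ℝ, d = combDist P u v}

/-- The circuit distance between two points: minimum length of a circuit walk joining them. -/
noncomputable def circuitDist (E : Set (V × V)) (P : Set (V → ℝ)) (u v : V → ℝ) : ℕ :=
  sInf {n | ∃ w : Fin (n + 1) → V → ℝ, IsCircuitWalk E P w ∧ w 0 = u ∧ w (Fin.last n) = v}

/-- The circuit diameter of `P`: maximum circuit distance between extreme points. -/
noncomputable def circuitDiam (E : Set (V × V)) (P : Set (V → ℝ)) : ℕ :=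
  sSup {d | ∃ u ∈ P.extremePoints ℝ, ∃ v ∈ P.extremePoints ℝ, d = circuitDist E P u v}

end DualNetworkFlow

/-- The constraint of the edge `e` holds with equality at `u`. -/
def IsTight {V : Type*} (c : V × V → ℝ) (u : V → ℝ) (e : V × V) : Prop :=
  -u e.1 + u e.2 = c e

/-- A point of the polyhedron whose tight constraints determine it uniquely. -/
structure IsRigidPoint {V : Type*} (E : Finset (V × V)) (v₀ : V) (c : V × V → ℝ)
    (u : V → ℝ) : Prop where
  mem : u ∈ dualPoly (↑E : Set (V × V)) v₀ c
  rigid : ∀ z : V → ℝ, z v₀ = 0 → (∀ e ∈ E, IsTight c u e → z e.1 = z e.2) → ∀ x, z x = 0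

/-- The graph on `V → ℝ` joining two distinct rigid points whose common tight constraints
cut out the line through them. -/
def rigidGraph {V : Type*} (E : Finset (V × V)) (v₀ : V) (c : V × V → ℝ) :
    SimpleGraph (V → ℝ) where
  Adj u w := u ≠ w ∧ IsRigidPoint E v₀ c u ∧ IsRigidPoint E v₀ c w ∧
    ∀ z : V → ℝ, z v₀ = 0 → (∀ e ∈ E, IsTight c u e → IsTight c w e → z e.1 = z e.2) →
      ∃ β : ℝ, z = β • (w - u)
  symm := ⟨by
    rintro u w ⟨hne, hu, hw, h⟩
    refine ⟨hne.symm, hw, hu, fun z hz hE => ?_⟩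
    obtain ⟨β, hβ⟩ := h z hz fun e he h₁ h₂ => hE e he h₂ h₁
    exact ⟨-β, by rw [hβ, neg_smul, ← smul_neg, neg_sub]⟩⟩
  loopless := ⟨fun _ h => h.1 rfl⟩

theorem IsTight.of_mem_openSegment {V : Type*} {E : Finset (V × V)} {v₀ : V} {c : V × V → ℝ}
    {x y z : V → ℝ} (hx : x ∈ dualPoly (↑E : Set (V × V)) v₀ c)
    (hy : y ∈ dualPoly (↑E : Set (V × V)) v₀ c) (hz : z ∈ openSegment ℝ x y)
    {e : V × V} (he : e ∈ E) (ht : IsTight c z e) : IsTight c x e := by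
  obtain ⟨a, b, ha, hb, hab, rfl⟩ := hz
  have h₁ := hx.2 e he
  have h₂ := hy.2 e he
  simp only [IsTight, Pi.add_apply, Pi.smul_apply, smul_eq_mul] at ht ⊢
  have hb' : b = 1 - a := by linarith
  subst hb'
  refine le_antisymm h₁ ?_
  nlinarith [mul_le_mul_of_nonneg_left h₂ hb.le]

theorem IsRigidPoint.mem_extremePoints {V : Type*} {E : Finset (V × V)} {v₀ : V}
    {c : V × V → ℝ} {u : V → ℝ} (hu : IsRigidPoint E v₀ c u) :
    u ∈ (dualPoly (↑E : Set (V × V)) v₀ c).extremePoints ℝ := by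
  refine ⟨hu.mem, fun x hx y hy hxy => ?_⟩
  have := hu.rigid (x - u) (by simp [hx.1, hu.mem.1]) fun e he ht => by
    have h := IsTight.of_mem_openSegment hx hy hxy he ht
    simp only [IsTight, Pi.sub_apply] at *
    linarith
  ext a
  have := this a
  simp only [Pi.sub_apply] at this
  linarith

theorem IsRigidPoint.of_mem_extremePoints {V : Type*} {E : Finset (V × V)} {v₀ : V}
    {c : V × V → ℝ} {u : V → ℝ}
    (hu : u ∈ (dualPoly (↑E : Set (V × V)) v₀ c).extremePoints ℝ) : IsRigidPoint E v₀ c u := by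
  refine ⟨hu.1, fun z hz hE => ?_⟩
  have hev : ∀ᶠ ε in nhdsWithin (0 : ℝ) (Set.Ioi 0),
      ∀ e ∈ E, ε * |z e.2 - z e.1| ≤ c e - (-u e.1 + u e.2) := by
    refine (Filter.eventually_all_finset E).2 fun e he => ?_
    by_cases ht : IsTight c u e
    · simp [hE e he ht, show c e = -u e.1 + u e.2 from ht.symm]
    · have hpos : 0 < c e - (-u e.1 + u e.2) := sub_pos.2 (lt_of_le_of_ne (hu.1.2 e he) ht)
      have hc : Filter.Tendsto (fun ε : ℝ => ε * |z e.2 - z e.1|)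
          (nhdsWithin (0 : ℝ) (Set.Ioi 0)) (nhds (0 * |z e.2 - z e.1|)) :=
        (Continuous.tendsto (by fun_prop) 0).mono_left nhdsWithin_le_nhds
      rw [zero_mul] at hc
      exact (hc.eventually_lt_const hpos).mono fun _ h => h.le
  obtain ⟨ε, hε, hpos⟩ := (hev.and self_mem_nhdsWithin).exists
  replace hpos : 0 < ε := hpos
  have hP : ∀ δ : ℝ, |δ| = ε → u + δ • z ∈ dualPoly (↑E : Set (V × V)) v₀ c := by
    intro δ hδ
    refine ⟨by simp [hu.1.1, hz], fun e he => ?_⟩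
    have h := hε e he
    rw [← hδ, ← abs_mul] at h
    have := (le_abs_self _).trans h
    simp only [Pi.add_apply, Pi.smul_apply, smul_eq_mul]
    linarith
  have h := hu.2 (hP ε (abs_of_pos hpos)) (hP (-ε) (by rw [abs_neg, abs_of_pos hpos]))
    ⟨1 / 2, 1 / 2, by norm_num, by norm_num, by norm_num, by ext; simp; ring⟩
  intro x
  have := congrFun h x
  simpa [hpos.ne'] using this

theorem rigidGraph.isExtreme_segment {V : Type*} {E : Finset (V × V)} {v₀ : V}
    {c : V × V → ℝ} {u w : V → ℝ} (h : (rigidGraph E v₀ c).Adj u w) :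
    IsExtreme ℝ (dualPoly (↑E : Set (V × V)) v₀ c) (segment ℝ u w) := by
  obtain ⟨hne, hu, hw, h⟩ := h
  refine ⟨?_, fun x hx y hy z hz hxy => ?_⟩
  · rintro _ ⟨a, b, ha, hb, hab, rfl⟩
    refine ⟨by simp [hu.mem.1, hw.mem.1], fun e he => ?_⟩
    have h₁ := mul_le_mul_of_nonneg_left (hu.mem.2 e he) ha
    have h₂ := mul_le_mul_of_nonneg_left (hw.mem.2 e he) hb
    have h₃ : c e = a * c e + b * c e := by rw [← add_mul, hab, one_mul]
    simp only [Pi.add_apply, Pi.smul_apply, smul_eq_mul]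
    linarith
  · obtain ⟨β, hβ⟩ := h (x - u) (by simp [hx.1, hu.mem.1]) fun e he h₁ h₂ => by
      have hz' : IsTight c z e := by
        obtain ⟨a, b, ha, hb, hab, rfl⟩ := hz
        simp only [IsTight, Pi.add_apply, Pi.smul_apply, smul_eq_mul] at *
        linear_combination a * h₁ + b * h₂ + c e * hab
      have h := IsTight.of_mem_openSegment hx hy hxy he hz'
      simp only [IsTight, Pi.sub_apply] at *
      linarith
    have hxe : x = u + β • (w - u) := by rw [← hβ]; abel
    have hβ0 : 0 ≤ β := by
      by_contra! hlt
      have hd : 0 < 1 - β := by linarith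
      have := (mem_extremePoints.1 hu.mem_extremePoints).2 x hx w hw.mem
        ⟨1 / (1 - β), -β / (1 - β), by positivity, div_pos (by linarith) hd,
          by field_simp; ring, by
            ext a; simp only [hxe, Pi.add_apply, Pi.smul_apply, Pi.sub_apply, smul_eq_mul]
            field_simp; ring⟩
      exact hne this.2.symm
    have hβ1 : β ≤ 1 := by
      by_contra! hlt
      have hd : 0 < β := by linarith
      have := (mem_extremePoints.1 hw.mem_extremePoints).2 x hx u hu.mem
        ⟨1 / β, (β - 1) / β, by positivity, div_pos (by linarith) hd,
          by field_simp; ring, by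
            ext a; simp only [hxe, Pi.add_apply, Pi.smul_apply, Pi.sub_apply, smul_eq_mul]
            field_simp; ring⟩
      exact hne this.2
    exact ⟨1 - β, β, by linarith, hβ0, by ring, by
      ext a; simp only [hxe, Pi.add_apply, Pi.smul_apply, Pi.sub_apply, smul_eq_mul]; ring⟩

theorem rigidGraph.isEdgeWalk_getVert {V : Type*} {E : Finset (V × V)} {v₀ : V}
    {c : V × V → ℝ} {u w : V → ℝ} (hu : IsRigidPoint E v₀ c u)
    (p : (rigidGraph E v₀ c).Walk u w) :
    IsEdgeWalk (dualPoly (↑E : Set (V × V)) v₀ c)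
      (fun i : Fin (p.length + 1) => p.getVert i) := by
  refine ⟨?_, fun i => ?_⟩
  · rintro ⟨i, hi⟩
    cases i with
    | zero => simpa using hu.mem_extremePoints
    | succ i => exact (p.adj_getVert_succ (by omega)).2.2.1.mem_extremePoints
  · have h := p.adj_getVert_succ i.2
    exact ⟨h.1, rigidGraph.isExtreme_segment h⟩

/-- Raising a set `C`, not entered by any tight edge, until some edge entering it becomes
tight. -/
theorem rigidGraph.exists_adj_raise {V : Type*} {E : Finset (V × V)} {v₀ : V}
    {c : V × V → ℝ} {u : V → ℝ} (hu : IsRigidPoint E v₀ c u) {C : Set V} {b : V}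
    (hv₀ : v₀ ∉ C) (hb : b ∈ C)
    (hin : ∀ e ∈ E, e.1 ∉ C → e.2 ∈ C → ¬ IsTight c u e)
    (hex : ∃ e ∈ E, e.1 ∉ C ∧ e.2 ∈ C)
    (hrig : ∀ z : V → ℝ, z v₀ = 0 →
      (∀ e ∈ E, IsTight c u e → (e.1 ∈ C ↔ e.2 ∈ C) → z e.1 = z e.2) →
      (∀ x ∉ C, z x = 0) ∧ ∀ x ∈ C, z x = z b) :
    ∃ w, (rigidGraph E v₀ c).Adj u w ∧ (∀ x ∉ C, w x = u x) ∧
      (∀ e, (e.1 ∈ C ↔ e.2 ∈ C) → (IsTight c w e ↔ IsTight c u e)) ∧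
      ∃ e ∈ E, e.1 ∉ C ∧ e.2 ∈ C ∧ IsTight c w e := by
  classical
  obtain ⟨e₀, he₀, hmin⟩ := Finset.exists_min_image
    (E.filter fun e => e.1 ∉ C ∧ e.2 ∈ C) (fun e => c e - (-u e.1 + u e.2))
    (by obtain ⟨e, he, h⟩ := hex; exact ⟨e, by simp [he, h]⟩)
  simp only [Finset.mem_filter] at he₀ hmin
  obtain ⟨he₀E, he₀1, he₀2⟩ := he₀
  set α := c e₀ - (-u e₀.1 + u e₀.2) with hα
  have hpos : 0 < α :=
    sub_pos.2 (lt_of_le_of_ne (hu.mem.2 e₀ he₀E) (hin e₀ he₀E he₀1 he₀2))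
  set w : V → ℝ := fun x => if x ∈ C then u x + α else u x with hw
  have hwC : ∀ x ∈ C, w x = u x + α := fun x hx => if_pos hx
  have hwn : ∀ x ∉ C, w x = u x := fun x hx => if_neg hx
  have hiff : ∀ e : V × V, (e.1 ∈ C ↔ e.2 ∈ C) → (IsTight c w e ↔ IsTight c u e) := by
    intro e he
    by_cases h : e.1 ∈ C
    · simp only [IsTight, hwC _ h, hwC _ (he.1 h)]
      constructor <;> intro h <;> linarith
    · simp only [IsTight, hwn _ h, hwn _ (mt he.2 h)]
  have hwt : IsTight c w e₀ := by
    simp only [IsTight, hwn _ he₀1, hwC _ he₀2, hα]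
    ring
  have hwP : w ∈ dualPoly (↑E : Set (V × V)) v₀ c := by
    refine ⟨by rw [hwn _ hv₀, hu.mem.1], fun e he => ?_⟩
    have h := hu.mem.2 e he
    by_cases h₁ : e.1 ∈ C <;> by_cases h₂ : e.2 ∈ C
    · rw [hwC _ h₁, hwC _ h₂]; linarith
    · rw [hwC _ h₁, hwn _ h₂]; linarith
    · rw [hwn _ h₁, hwC _ h₂]; linarith [hmin e ⟨he, h₁, h₂⟩]
    · rw [hwn _ h₁, hwn _ h₂]; linarith
  refine ⟨w, ⟨?_, hu, ⟨hwP, fun z hz hE => ?_⟩, fun z hz hE => ?_⟩, hwn, hiff,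
    e₀, he₀E, he₀1, he₀2, hwt⟩
  · intro h
    have := congrFun h b
    rw [hwC b hb] at this
    linarith
  · obtain ⟨h₁, h₂⟩ := hrig z hz fun e he ht hC => hE e he ((hiff e hC).2 ht)
    have h₃ := hE e₀ he₀E hwt
    rw [h₁ _ he₀1, h₂ _ he₀2] at h₃
    intro x
    by_cases hx : x ∈ C
    · rw [h₂ x hx, ← h₃]
    · exact h₁ x hx
  · obtain ⟨h₁, h₂⟩ := hrig z hz fun e he ht hC => hE e he ht ((hiff e hC).2 ht)
    refine ⟨z b / α, ?_⟩
    ext x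
    by_cases hx : x ∈ C
    · simp [hwC x hx, h₂ x hx, hpos.ne']
    · simp [hwn x hx, h₁ x hx]

/-- The nodes reachable from `S` along directed edges that are tight at `u`. -/
inductive TightReach {V : Type*} (E : Finset (V × V)) (c : V × V → ℝ) (u : V → ℝ)
    (S : Set V) : V → Prop
  | of_mem {x : V} : x ∈ S → TightReach E c u S x
  | step {x y : V} : TightReach E c u S x → (x, y) ∈ E → IsTight c u (x, y) →
      TightReach E c u S y

/-- The nodes joined to `b` by undirected paths of edges tight at `u` that avoid `R`. -/
inductive TightComponent {V : Type*} (E : Finset (V × V)) (c : V × V → ℝ) (u : V → ℝ)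
    (R : V → Prop) (b : V) : V → Prop
  | refl : TightComponent E c u R b b
  | step {x y : V} : TightComponent E c u R b x → ¬ R y →
      (((x, y) ∈ E ∧ IsTight c u (x, y)) ∨ ((y, x) ∈ E ∧ IsTight c u (y, x))) →
      TightComponent E c u R b y

theorem TightComponent.notMem {V : Type*} {E : Finset (V × V)} {c : V × V → ℝ} {u : V → ℝ}
    {R : V → Prop} {b x : V} (h : TightComponent E c u R b x) (hb : ¬ R b) : ¬ R x := by
  cases h with
  | refl => exact hb
  | step _ h _ => exact h

theorem TightReach.le_of_agree {V : Type*} {E : Finset (V × V)} {v₀ : V} {c : V × V → ℝ}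
    {u v : V → ℝ} {S : Set V} {x : V} (hv : v ∈ dualPoly (↑E : Set (V × V)) v₀ c)
    (hS : ∀ x ∈ S, u x = v x) (h : TightReach E c u S x) : v x ≤ u x := by
  induction h with
  | of_mem hx => exact (hS _ hx).ge
  | step _ he ht ih =>
    have := hv.2 _ he
    simp only [IsTight] at ht this
    linarith

/-- The constraints tight at `v` inside `S` determine `v` on `S`. -/
def IsRigidOn {V : Type*} (E : Finset (V × V)) (v₀ : V) (c : V × V → ℝ) (v : V → ℝ)
    (S : Set V) : Prop :=
  ∀ z : V → ℝ, z v₀ = 0 →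
    (∀ e ∈ E, e.1 ∈ S → e.2 ∈ S → IsTight c v e → z e.1 = z e.2) → ∀ x ∈ S, z x = 0

/-- The number of edges that can still enter the tight set while the reachable set grows. -/
noncomputable def slackCount {V : Type*} (E : Finset (V × V)) (c : V × V → ℝ) (u : V → ℝ)
    (S : Set V) : ℕ :=
  {e : V × V | e ∈ E ∧ ¬ TightReach E c u S e.2 ∧ ¬ IsTight c u e}.ncard

/-- A potential bounding the number of steps in terms of the unreached nodes. -/
noncomputable def nodePotential {V : Type*} [Fintype V] (E : Finset (V × V)) (c : V × V → ℝ)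
    (u : V → ℝ) (S : Set V) (b : V) : ℕ :=
  (Fintype.card V - {x | TightReach E c u S x}.ncard).choose 2 +
    (Fintype.card V - {x | TightReach E c u S x}.ncard + 1 -
      {x | TightComponent E c u (TightReach E c u S) b x}.ncard)

theorem nodePotential_le {V : Type*} [Fintype V] (E : Finset (V × V)) (c : V × V → ℝ)
    (u : V → ℝ) (S : Set V) (b : V) :
    nodePotential E c u S b ≤
      (Fintype.card V - {x | TightReach E c u S x}.ncard + 1).choose 2 := by
  have : 0 < {x | TightComponent E c u (TightReach E c u S) b x}.ncard :=
    (Set.ncard_pos (Set.toFinite _)).2 ⟨b, .refl⟩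
  have h (m : ℕ) : (m + 1).choose 2 = m + m.choose 2 := by
    rw [Nat.choose_succ_succ' m 1, Nat.choose_one_right]
  rw [nodePotential, h]
  omega

theorem rigidGraph.exists_adj_step {V : Type*} [Fintype V] {E : Finset (V × V)} {v₀ : V}
    {c : V × V → ℝ} {u v : V → ℝ} {S : Set V} {a b : V} (hv₀ : v₀ ∈ S)
    (hS : IsRigidOn E v₀ c v S) (hab : (a, b) ∈ E) (ha : a ∈ S)
    (hu : IsRigidPoint E v₀ c u) (huv : ∀ x ∈ S, u x = v x) (hb : ¬ TightReach E c u S b) :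
    ∃ w, (rigidGraph E v₀ c).Adj u w ∧ (∀ x ∈ S, w x = v x) ∧
      slackCount E c w S < slackCount E c u S ∧
      nodePotential E c w S b < nodePotential E c u S b := by
  set R := TightReach E c u S
  set C : Set V := {x | TightComponent E c u R b x}
  have hCR : ∀ x ∈ C, ¬ R x := fun x hx => TightComponent.notMem hx hb
  have hSC : ∀ x ∈ S, x ∉ C := fun x hx hxC => hCR x hxC (.of_mem hx)
  have hin : ∀ e ∈ E, e.1 ∉ C → e.2 ∈ C → ¬ IsTight c u e := by
    intro e he h₁ h₂ ht
    by_cases h : R e.1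
    · exact hCR _ h₂ (.step h he ht)
    · exact h₁ (TightComponent.step h₂ h (.inr ⟨he, ht⟩))
  have hout : ∀ e ∈ E, e.1 ∈ C → e.2 ∉ C → IsTight c u e → R e.2 := by
    intro e he h₁ h₂ ht
    by_contra h
    exact h₂ (TightComponent.step h₁ h (.inl ⟨he, ht⟩))
  have hrig : ∀ z : V → ℝ, z v₀ = 0 →
      (∀ e ∈ E, IsTight c u e → (e.1 ∈ C ↔ e.2 ∈ C) → z e.1 = z e.2) →
      (∀ x ∉ C, z x = 0) ∧ ∀ x ∈ C, z x = z b := by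
    classical
    intro z hz hE
    have hzR : ∀ x, R x → z x = 0 := by
      intro x hx
      induction hx with
      | of_mem hx =>
        refine hS z hz (fun e he h₁ h₂ ht => hE e he ?_ ?_) _ hx
        · simpa only [IsTight, huv _ h₁, huv _ h₂] using ht
        · exact iff_of_false (hSC _ h₁) (hSC _ h₂)
      | step hx he ht ih =>
        rw [← ih]
        exact (hE _ he ht (iff_of_false (fun h => hCR _ h hx)
          (fun h => hCR _ h (.step hx he ht)))).symm
    constructor
    · intro x hx
      have := hu.rigid (fun x => if x ∈ C then 0 else z x) (by simp [hSC _ hv₀, hz])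
        (fun e he ht => by
          by_cases h₁ : e.1 ∈ C <;> by_cases h₂ : e.2 ∈ C
          · simp [h₁, h₂]
          · simp [h₁, h₂, hzR _ (hout e he h₁ h₂ ht)]
          · exact absurd ht (hin e he h₁ h₂)
          · simpa [h₁, h₂] using hE e he ht (iff_of_false h₁ h₂)) x
      simpa [hx] using this
    · intro x hx
      induction hx with
      | refl => rfl
      | step hx hy h ih =>
        rw [← ih]
        have hy' : _ ∈ C := TightComponent.step hx hy h
        rcases h with ⟨he, ht⟩ | ⟨he, ht⟩
        · exact (hE _ he ht (iff_of_true hx hy')).symm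
        · exact hE _ he ht (iff_of_true hy' hx)
  obtain ⟨w, hadj, hwn, hiff, e, he, he₁, he₂, ht⟩ := rigidGraph.exists_adj_raise hu
    (hSC _ hv₀) (show b ∈ C from .refl) hin ⟨_, hab, hSC _ ha, .refl⟩ hrig
  have hRR : ∀ x, R x → TightReach E c w S x := by
    intro x hx
    induction hx with
    | of_mem hx => exact .of_mem hx
    | step hx he ht ih =>
      exact .step ih he ((hiff _ (iff_of_false (fun h => hCR _ h hx)
        (fun h => hCR _ h (.step hx he ht)))).2 ht)
  refine ⟨w, hadj, fun x hx => (hwn x (hSC x hx)).trans (huv x hx), ?_, ?_⟩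
  · refine Set.ncard_lt_ncard ((Set.ssubset_iff_of_subset ?_).2
      ⟨e, ⟨he, hCR _ he₂, hin e he he₁ he₂⟩, fun h => h.2.2 ht⟩) (Set.toFinite _)
    rintro f ⟨hf, hf₁, hf₂⟩
    refine ⟨hf, fun h => hf₁ (hRR _ h), fun h => ?_⟩
    by_cases h₁ : f.1 ∈ C <;> by_cases h₂ : f.2 ∈ C
    · exact hf₂ ((hiff f (iff_of_true h₁ h₂)).2 h)
    · exact hf₁ (hRR _ (hout f hf h₁ h₂ h))
    · exact hin f hf h₁ h₂ h
    · exact hf₂ ((hiff f (iff_of_false h₁ h₂)).2 h)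
  · have hcard : ∀ A : Set V, A.ncard ≤ Fintype.card V := fun A => by
      rw [← Nat.card_eq_fintype_card]; exact Set.ncard_le_card A
    have hCle : C.ncard + {x | R x}.ncard ≤ Fintype.card V := by
      rw [← Set.ncard_union_eq (t := {x | R x}) (Set.disjoint_left.2 hCR)]
      exact hcard _
    by_cases hgrow : ∃ x, TightReach E c w S x ∧ ¬ R x
    · obtain ⟨x, hx, hxR⟩ := hgrow
      have hlt : {x | R x}.ncard < {x | TightReach E c w S x}.ncard :=
        Set.ncard_lt_ncard ((Set.ssubset_iff_of_subset hRR).2 ⟨x, hx, hxR⟩)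
      refine (nodePotential_le E c w S b).trans_lt ?_
      have hmono : (Fintype.card V - {x | TightReach E c w S x}.ncard + 1).choose 2 ≤
          (Fintype.card V - {x | R x}.ncard).choose 2 := by
        apply Nat.choose_le_choose
        have := hcard {x | TightReach E c w S x}
        omega
      change _ < (Fintype.card V - {x | R x}.ncard).choose 2 +
        (Fintype.card V - {x | R x}.ncard + 1 - C.ncard)
      omega
    · push Not at hgrow
      have heq : TightReach E c w S = R := by
        ext x
        exact ⟨hgrow x, hRR x⟩
      have hsub : C ⊆ {x | TightComponent E c w R b x} := by
        intro x hx
        induction hx with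
        | refl => exact .refl
        | step hx hy h ih =>
          have hx' : _ ∈ C := hx
          have hy' : _ ∈ C := TightComponent.step hx hy h
          refine TightComponent.step ih hy (h.imp ?_ ?_)
          · exact fun h => ⟨h.1, (hiff _ (iff_of_true hx' hy')).2 h.2⟩
          · exact fun h => ⟨h.1, (hiff _ (iff_of_true hy' hx')).2 h.2⟩
      have heR : ¬ R e.1 := fun h =>
        hCR _ he₂ (hgrow _ (.step (hRR _ h) he ht))
      have hlt : C.ncard < {x | TightComponent E c w R b x}.ncard :=
        Set.ncard_lt_ncard ((Set.ssubset_iff_of_subset hsub).2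
          ⟨e.1, TightComponent.step (hsub he₂) heR (.inr ⟨he, ht⟩), he₁⟩)
      simp only [nodePotential, heq]
      change _ < (Fintype.card V - {x | R x}.ncard).choose 2 +
        (Fintype.card V - {x | R x}.ncard + 1 - C.ncard)
      omega

/-- Walking until the tight edge `(a, b)` of the target `v` leaving `S` is tight. -/
theorem rigidGraph.exists_walk_agree_head {V : Type*} [Fintype V] {E : Finset (V × V)} {v₀ : V}
    {c : V × V → ℝ} {u v : V → ℝ} {S : Set V} {a b : V}
    (hv : v ∈ dualPoly (↑E : Set (V × V)) v₀ c) (hv₀ : v₀ ∈ S)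
    (hS : IsRigidOn E v₀ c v S) (hab : (a, b) ∈ E) (ha : a ∈ S) (ht : IsTight c v (a, b))
    (hu : IsRigidPoint E v₀ c u) (huv : ∀ x ∈ S, u x = v x) :
    ∃ (w : V → ℝ) (p : (rigidGraph E v₀ c).Walk u w), IsRigidPoint E v₀ c w ∧
      (∀ x ∈ S, w x = v x) ∧ w b = v b ∧ p.length ≤ E.card ∧
      p.length ≤ (Fintype.card V - S.ncard + 1).choose 2 := by
  suffices H : ∀ (k : ℕ) (u : V → ℝ), slackCount E c u S = k → IsRigidPoint E v₀ c u →
      (∀ x ∈ S, u x = v x) →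
      ∃ (w : V → ℝ) (p : (rigidGraph E v₀ c).Walk u w), IsRigidPoint E v₀ c w ∧
        (∀ x ∈ S, w x = v x) ∧ w b = v b ∧ p.length ≤ slackCount E c u S ∧
        p.length ≤ nodePotential E c u S b by
    obtain ⟨w, p, h₁, h₂, h₃, h₄, h₅⟩ := H _ u rfl hu huv
    refine ⟨w, p, h₁, h₂, h₃, h₄.trans ?_, h₅.trans ((nodePotential_le E c u S b).trans ?_)⟩
    · rw [← Set.ncard_coe_finset]
      exact Set.ncard_le_ncard (fun e he => he.1) (Set.toFinite _)
    · apply Nat.choose_le_choose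
      have : S.ncard ≤ {x | TightReach E c u S x}.ncard :=
        Set.ncard_le_ncard (fun x hx => .of_mem hx) (Set.toFinite _)
      omega
  intro k
  induction k using Nat.strong_induction_on with
  | _ k ih =>
    rintro u rfl hu huv
    by_cases hb : TightReach E c u S b
    · refine ⟨u, .nil, hu, huv, le_antisymm ?_ (hb.le_of_agree hv huv), by simp, by simp⟩
      have := hu.mem.2 _ hab
      simp only [IsTight, huv a ha] at ht this
      linarith
    · obtain ⟨u', hadj, huv', h₁, h₂⟩ :=
        rigidGraph.exists_adj_step hv₀ hS hab ha hu huv hb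
      obtain ⟨w, p, hw, hwS, hwb, hp₁, hp₂⟩ := ih _ h₁ u' rfl hadj.2.2.1 huv'
      refine ⟨w, .cons hadj p, hw, hwS, hwb, ?_, ?_⟩ <;>
        rw [SimpleGraph.Walk.length_cons] <;> omega

/-- The edge set with all edges reversed. -/
def reverseEdges {V : Type*} (E : Finset (V × V)) : Finset (V × V) :=
  E.map (Equiv.prodComm V V).toEmbedding

theorem mem_reverseEdges {V : Type*} {E : Finset (V × V)} {a b : V} :
    (a, b) ∈ reverseEdges E ↔ (b, a) ∈ E := by
  simp [reverseEdges]

theorem isTight_reverse_neg {V : Type*} {c : V × V → ℝ} {u : V → ℝ} {a b : V} :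
    IsTight (c ∘ Prod.swap) (-u) (a, b) ↔ IsTight c u (b, a) := by
  simp only [IsTight, Pi.neg_apply, neg_neg, Function.comp, Prod.swap, add_comm]

theorem mem_dualPoly_reverse_neg {V : Type*} {E : Finset (V × V)} {v₀ : V} {c : V × V → ℝ}
    {u : V → ℝ} (hu : u ∈ dualPoly (↑E : Set (V × V)) v₀ c) :
    -u ∈ dualPoly (↑(reverseEdges E) : Set (V × V)) v₀ (c ∘ Prod.swap) := by
  refine ⟨by simp [hu.1], ?_⟩
  rintro ⟨a, b⟩ he
  have := hu.2 _ (mem_reverseEdges.1 he)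
  simp only [Pi.neg_apply, Function.comp, Prod.swap] at this ⊢
  linarith

theorem IsRigidPoint.reverse_neg {V : Type*} {E : Finset (V × V)} {v₀ : V} {c : V × V → ℝ}
    {u : V → ℝ} (hu : IsRigidPoint E v₀ c u) :
    IsRigidPoint (reverseEdges E) v₀ (c ∘ Prod.swap) (-u) :=
  ⟨mem_dualPoly_reverse_neg hu.mem, fun z hz hE => hu.rigid z hz fun ⟨_, _⟩ he ht =>
    (hE _ (mem_reverseEdges.2 he) (isTight_reverse_neg.2 ht)).symm⟩

theorem IsRigidOn.reverse_neg {V : Type*} {E : Finset (V × V)} {v₀ : V} {c : V × V → ℝ}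
    {v : V → ℝ} {S : Set V} (hS : IsRigidOn E v₀ c v S) :
    IsRigidOn (reverseEdges E) v₀ (c ∘ Prod.swap) (-v) S :=
  fun z hz hE => hS z hz fun ⟨_, _⟩ he h₁ h₂ ht =>
    (hE _ (mem_reverseEdges.2 he) h₂ h₁ (isTight_reverse_neg.2 ht)).symm

theorem reverseEdges_reverseEdges {V : Type*} (E : Finset (V × V)) :
    reverseEdges (reverseEdges E) = E := by
  ext ⟨a, b⟩
  rw [mem_reverseEdges, mem_reverseEdges]

theorem IsRigidPoint.of_reverse {V : Type*} {E : Finset (V × V)} {v₀ : V} {c : V × V → ℝ}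
    {u : V → ℝ} (hu : IsRigidPoint (reverseEdges E) v₀ (c ∘ Prod.swap) u) :
    IsRigidPoint E v₀ c (-u) := by
  have := hu.reverse_neg
  rwa [reverseEdges_reverseEdges, Function.comp_assoc, Prod.swap_swap_eq,
    Function.comp_id] at this

/-- Negation maps the rigid graph of the reversed network to the original one. -/
def rigidGraph.negHom {V : Type*} (E : Finset (V × V)) (v₀ : V) (c : V × V → ℝ) :
    rigidGraph (reverseEdges E) v₀ (c ∘ Prod.swap) →g rigidGraph E v₀ c where
  toFun u := -u
  map_rel' := by
    rintro u w ⟨hne, hu, hw, h⟩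
    refine ⟨neg_injective.ne hne, hu.of_reverse, hw.of_reverse, fun z hz hE => ?_⟩
    obtain ⟨β, hβ⟩ := h z hz fun ⟨a, b⟩ he h₁ h₂ => by
      rw [← neg_neg u, isTight_reverse_neg] at h₁
      rw [← neg_neg w, isTight_reverse_neg] at h₂
      exact (hE _ (mem_reverseEdges.1 he) h₁ h₂).symm
    exact ⟨-β, by rw [hβ]; module⟩

/-- Walking until the tight edge `(b, a)` of the target `v` entering `S` is tight. -/
theorem rigidGraph.exists_walk_agree_tail {V : Type*} [Fintype V] {E : Finset (V × V)} {v₀ : V}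
    {c : V × V → ℝ} {u v : V → ℝ} {S : Set V} {a b : V}
    (hv : v ∈ dualPoly (↑E : Set (V × V)) v₀ c) (hv₀ : v₀ ∈ S)
    (hS : IsRigidOn E v₀ c v S) (hba : (b, a) ∈ E) (ha : a ∈ S) (ht : IsTight c v (b, a))
    (hu : IsRigidPoint E v₀ c u) (huv : ∀ x ∈ S, u x = v x) :
    ∃ (w : V → ℝ) (p : (rigidGraph E v₀ c).Walk u w), IsRigidPoint E v₀ c w ∧
      (∀ x ∈ S, w x = v x) ∧ w b = v b ∧ p.length ≤ E.card ∧
      p.length ≤ (Fintype.card V - S.ncard + 1).choose 2 := by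
  obtain ⟨w, p, hw, hwS, hwb, hp₁, hp₂⟩ := rigidGraph.exists_walk_agree_head
    (mem_dualPoly_reverse_neg hv) hv₀ hS.reverse_neg (mem_reverseEdges.2 hba) ha
    (isTight_reverse_neg.2 ht) hu.reverse_neg (fun x hx => by simp [huv x hx])
  refine ⟨-w, (p.map (rigidGraph.negHom E v₀ c)).copy (neg_neg u) rfl, hw.of_reverse,
    fun x hx => by simp [hwS x hx], by simp [hwb], ?_, ?_⟩
  · refine ((SimpleGraph.Walk.length_copy ..).trans (SimpleGraph.Walk.length_map ..)).trans_le ?_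
    simpa [reverseEdges] using hp₁
  · exact ((SimpleGraph.Walk.length_copy ..).trans (SimpleGraph.Walk.length_map ..)).trans_le hp₂

theorem IsRigidOn.insert {V : Type*} {E : Finset (V × V)} {v₀ : V} {c : V × V → ℝ}
    {v : V → ℝ} {S : Set V} {a b : V} (hS : IsRigidOn E v₀ c v S) (ha : a ∈ S)
    (h : ((a, b) ∈ E ∧ IsTight c v (a, b)) ∨ ((b, a) ∈ E ∧ IsTight c v (b, a))) :
    IsRigidOn E v₀ c v (Insert.insert b S) := by
  intro z hz hE
  have hzS := hS z hz fun e he h₁ h₂ ht => hE e he (.inr h₁) (.inr h₂) ht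
  rintro x (rfl | hx)
  · rw [← hzS a ha]
    rcases h with ⟨he, ht⟩ | ⟨he, ht⟩
    · exact (hE _ he (.inr ha) (.inl rfl) ht).symm
    · exact hE _ he (.inl rfl) (.inr ha) ht
  · exact hzS x hx

theorem IsRigidPoint.exists_tight_crossing {V : Type*} {E : Finset (V × V)} {v₀ : V}
    {c : V × V → ℝ} {v : V → ℝ} (hv : IsRigidPoint E v₀ c v) {S : Set V} (hv₀ : v₀ ∈ S)
    (hS : S ≠ Set.univ) :
    ∃ a ∈ S, ∃ b ∉ S,
      ((a, b) ∈ E ∧ IsTight c v (a, b)) ∨ ((b, a) ∈ E ∧ IsTight c v (b, a)) := by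
  classical
  by_contra! H
  obtain ⟨x, hx⟩ := (Set.ne_univ_iff_exists_notMem S).1 hS
  have := hv.rigid (fun x => if x ∈ S then 0 else 1) (by simp [hv₀]) (fun ⟨a, b⟩ he ht => by
    by_cases h₁ : a ∈ S <;> by_cases h₂ : b ∈ S
    · simp [h₁, h₂]
    · exact absurd ht ((H a h₁ b h₂).1 he)
    · exact absurd ht ((H b h₂ a h₁).2 he)
    · simp [h₁, h₂]) x
  simp [hx] at this

theorem rigidGraph.exists_walk_length_le {V : Type*} [Fintype V] {E : Finset (V × V)} {v₀ : V}
    {c : V × V → ℝ} {v : V → ℝ} (hv : IsRigidPoint E v₀ c v) (j : ℕ) :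
    ∀ (S : Set V) (u : V → ℝ), Fintype.card V - S.ncard = j → v₀ ∈ S → IsRigidOn E v₀ c v S →
      IsRigidPoint E v₀ c u → (∀ x ∈ S, u x = v x) →
      ∃ p : (rigidGraph E v₀ c).Walk u v,
        p.length ≤ j * E.card ∧ p.length ≤ (j + 2).choose 3 := by
  induction j with
  | zero =>
    intro S u hj _ _ _ huv
    have hSu : S = Set.univ := by
      apply Set.eq_of_subset_of_ncard_le (Set.subset_univ S)
      rw [Set.ncard_univ, Nat.card_eq_fintype_card]
      omega
    obtain rfl : u = v := funext fun x => huv x (hSu ▸ Set.mem_univ x)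
    exact ⟨.nil, by simp, by simp⟩
  | succ j ih =>
    intro S u hj hv₀ hS hu huv
    have hSu : S ≠ Set.univ := by
      rintro rfl
      rw [Set.ncard_univ, Nat.card_eq_fintype_card] at hj
      omega
    obtain ⟨a, ha, b, hb, hab⟩ := hv.exists_tight_crossing hv₀ hSu
    obtain ⟨w, p, hw, hwS, hwb, hp₁, hp₂⟩ : ∃ (w : V → ℝ) (p : (rigidGraph E v₀ c).Walk u w),
        IsRigidPoint E v₀ c w ∧ (∀ x ∈ S, w x = v x) ∧ w b = v b ∧ p.length ≤ E.card ∧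
        p.length ≤ (Fintype.card V - S.ncard + 1).choose 2 := by
      rcases hab with ⟨he, ht⟩ | ⟨he, ht⟩
      · exact rigidGraph.exists_walk_agree_head hv.mem hv₀ hS he ha ht hu huv
      · exact rigidGraph.exists_walk_agree_tail hv.mem hv₀ hS he ha ht hu huv
    obtain ⟨q, hq₁, hq₂⟩ := ih (insert b S) w
      (by rw [Set.ncard_insert_of_notMem hb (Set.toFinite _)]; omega) (.inr hv₀)
      (hS.insert ha hab) hw (by rintro x (rfl | hx); exacts [hwb, hwS x hx])
    refine ⟨p.append q, ?_, ?_⟩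
    · rw [SimpleGraph.Walk.length_append, add_mul, one_mul]
      omega
    · rw [SimpleGraph.Walk.length_append, Nat.choose_succ_succ' (j + 2) 2]
      rw [hj] at hp₂
      exact add_le_add hp₂ hq₂

theorem cast_choose_add_two_three (m : ℕ) :
    ((m + 2).choose 3 : ℝ) = m * (m + 1) * (m + 2) / 6 := by
  induction m with
  | zero => simp
  | succ m ih =>
    rw [Nat.choose_succ_succ' (m + 2) 2, Nat.cast_add, ih, Nat.cast_choose_two]
    push_cast
    ring


/-- **Theorem 2 (Combinatorial diameter).**
For a directed graph `G = (V, E)` (no self-loops) whose underlying undirected graph is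
connected, with distinguished node `v₀` and costs `c`, any two extreme points of the dual
network flow polyhedron `P(G,c)` are joined by an edge walk of length at most
`min ((|V| - 1) * |E|) (|V|^3 / 6)`. -/
theorem comb_diameter_bound {V : Type*} [Fintype V] (E : Finset (V × V))
    (hloop : ∀ e ∈ E, e.1 ≠ e.2) (v₀ : V)
    (hconn : UConnected (↑E : Set (V × V))) (c : V × V → ℝ) :
    ∀ u ∈ (dualPoly (↑E : Set (V × V)) v₀ c).extremePoints ℝ,
      ∀ v ∈ (dualPoly (↑E : Set (V × V)) v₀ c).extremePoints ℝ,
        ∃ (n : ℕ) (w : Fin (n + 1) → V → ℝ),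
          IsEdgeWalk (dualPoly (↑E : Set (V × V)) v₀ c) w ∧ w 0 = u ∧ w (Fin.last n) = v ∧
          (n : ℝ) ≤ min (((Fintype.card V : ℝ) - 1) * (E.card : ℝ))
            ((Fintype.card V : ℝ) ^ 3 / 6) := by
  intro u hu v hv
  replace hu := IsRigidPoint.of_mem_extremePoints hu
  replace hv := IsRigidPoint.of_mem_extremePoints hv
  obtain ⟨p, hp₁, hp₂⟩ := rigidGraph.exists_walk_length_le hv (Fintype.card V - 1) {v₀} u
    (by rw [Set.ncard_singleton]) rfl (by rintro z hz - x rfl; exact hz) hu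
    (by rintro x rfl; rw [hu.mem.1, hv.mem.1])
  refine ⟨p.length, fun i => p.getVert i, rigidGraph.isEdgeWalk_getVert hu p,
    p.getVert_zero, p.getVert_length, ?_⟩
  obtain ⟨m, hm⟩ : ∃ m, Fintype.card V = m + 1 :=
    Nat.exists_eq_succ_of_ne_zero (Fintype.card_pos_iff.2 ⟨v₀⟩).ne'
  rw [hm, Nat.add_sub_cancel] at hp₁ hp₂
  rw [hm]
  push_cast
  refine le_min ?_ ?_
  · rw [add_sub_cancel_right]
    exact_mod_cast hp₁
  · refine (Nat.cast_le.2 hp₂).trans ?_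
    rw [cast_choose_add_two_three]
    nlinarith [(m.cast_nonneg : (0 : ℝ) ≤ m)]
end

section
/- Let G = (V, E) be a directed graph whose underlying undirected graph is connected, with distinguished node v₀, and let c : E → ℝ. Then any two extreme points of the dual network flow polyhedron P(G,c) are joined by a circuit walk of length at most |V|·(|V| − 1)/2; that is, the circuit diameter of P(G,c) is bounded above by |V|·(|V| − 1)/2. -/
open scoped BigOperators

namespace DualNetworkFlow

variable {V : Type*} {E : Set (V × V)} {v₀ : V} {c : V × V → ℝ}

/-- The edge `(a, b)` belongs to `E` and its constraint is active at `u`. -/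
def Tight (E : Set (V × V)) (c : V × V → ℝ) (u : V → ℝ) (a b : V) : Prop :=
  (a, b) ∈ E ∧ -u a + u b = c (a, b)

/-- At an extreme point the active edges connect the whole graph: a function constant along
active edges is constant. -/
theorem eq_of_tight_imp_eq [Finite V] {v : V → ℝ}
    (hv : v ∈ (dualPoly E v₀ c).extremePoints ℝ) {α : Type*} (f : V → α)
    (hf : ∀ a b, Tight E c v a b → f a = f b) (x : V) : f x = f v₀ := by
  classical
  by_contra hx
  set K : Set V := {y | f y ≠ f v₀} with hK
  obtain ⟨hvP, hext⟩ := hv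
  obtain ⟨ε, hε, hslack⟩ : ∃ ε > 0, ∀ e ∈ E, f e.1 ≠ f e.2 → ε ≤ c e - (-v e.1 + v e.2) := by
    have hfin : {e | e ∈ E ∧ f e.1 ≠ f e.2}.Finite := Set.toFinite _
    rcases Set.eq_empty_or_nonempty {e | e ∈ E ∧ f e.1 ≠ f e.2} with h | h
    · refine ⟨1, one_pos, fun e he hne => ?_⟩
      exact absurd (show e ∈ {e | e ∈ E ∧ f e.1 ≠ f e.2} from ⟨he, hne⟩) (by simp [h])
    · obtain ⟨e₀, he₀, hmin⟩ :=
        hfin.exists_minimalFor (fun e => c e - (-v e.1 + v e.2)) _ h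
      refine ⟨c e₀ - (-v e₀.1 + v e₀.2), ?_, fun e he hne => ?_⟩
      · have h1 := hvP.2 e₀ he₀.1
        have h2 : -v e₀.1 + v e₀.2 ≠ c e₀ := fun h => he₀.2 (hf _ _ ⟨he₀.1, h⟩)
        exact sub_pos.2 (lt_of_le_of_ne h1 h2)
      · by_contra hlt
        exact hlt (hmin ⟨he, hne⟩ (not_le.1 hlt).le)
  have hmem : ∀ t : ℝ, |t| ≤ ε → v + t • K.indicator 1 ∈ dualPoly E v₀ c := by
    intro t ht
    obtain ⟨ht1, ht2⟩ := abs_le.1 ht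
    refine ⟨by simp [hK, hvP.1], fun e he => ?_⟩
    have h1 := hvP.2 e he
    by_cases hne : f e.1 = f e.2
    · have : K.indicator (1 : V → ℝ) e.1 = K.indicator 1 e.2 := by
        simp [Set.indicator, hK, hne]
      simp only [Pi.add_apply, Pi.smul_apply, this]
      linarith
    · have h2 := hslack e he hne
      simp only [Pi.add_apply, Pi.smul_apply, Set.indicator, Pi.one_apply, smul_eq_mul]
      split_ifs <;> linarith
  have hseg : v ∈ openSegment ℝ (v + ε • K.indicator 1) (v + (-ε) • K.indicator 1) := by
    refine ⟨1 / 2, 1 / 2, by norm_num, by norm_num, by norm_num, ?_⟩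
    ext y
    simp only [Pi.add_apply, Pi.smul_apply, smul_eq_mul]
    ring
  have h := hext (hmem ε (abs_of_pos hε).le) (hmem (-ε) (by simp [abs_of_pos hε])) hseg
  have h' := congrFun h x
  have hxK : x ∈ K := hx
  simp [hxK] at h'
  exact hε.ne' h'

/-- The nodes from which `b` is reached along edges active at `u` and reversed `F`-edges. -/
def reachSet (E : Set (V × V)) (c : V × V → ℝ) (F : V → V → Prop) (u : V → ℝ) (b : V) : Set V :=
  {x | Relation.ReflTransGen (fun x y => Tight E c u x y ∨ F y x) x b}

theorem mem_reachSet_self (F : V → V → Prop) (u : V → ℝ) (b : V) :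
    b ∈ reachSet E c F u b := Relation.ReflTransGen.refl

theorem mem_reachSet_of_tight {F : V → V → Prop} {u : V → ℝ} {x y b : V}
    (h : Tight E c u x y) (hy : y ∈ reachSet E c F u b) : x ∈ reachSet E c F u b :=
  Relation.ReflTransGen.head (Or.inl h) hy

theorem mem_reachSet_iff_of_rel {F : V → V → Prop} {u : V → ℝ}
    (hF : ∀ x y, F x y → Tight E c u x y) {x y b : V} (h : F x y) :
    x ∈ reachSet E c F u b ↔ y ∈ reachSet E c F u b :=
  ⟨fun hx => Relation.ReflTransGen.head (Or.inr h) hx, mem_reachSet_of_tight (hF _ _ h)⟩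

theorem mem_reachSet_iff_of_quot_eq {F : V → V → Prop} {u : V → ℝ}
    (hF : ∀ x y, F x y → Tight E c u x y) {x y b : V} (h : Quot.mk F x = Quot.mk F y) :
    x ∈ reachSet E c F u b ↔ y ∈ reachSet E c F u b := by
  have h' := congrArg (Quot.lift (· ∈ reachSet E c F u b)
    fun _ _ h => propext (mem_reachSet_iff_of_rel hF h)) h
  exact iff_of_eq h'

theorem uAdj_symm {a b : V} (h : UAdj E a b) : UAdj E b a := h.symm

theorem reflTransGen_inside_symm {S : Set V} {a b : V}
    (h : Relation.ReflTransGen (fun x y => x ∈ S ∧ y ∈ S ∧ UAdj E x y) a b) :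
    Relation.ReflTransGen (fun x y => x ∈ S ∧ y ∈ S ∧ UAdj E x y) b a :=
  have : Std.Symm fun x y => x ∈ S ∧ y ∈ S ∧ UAdj E x y :=
    ⟨fun _ _ h => ⟨h.2.1, h.1, uAdj_symm h.2.2⟩⟩
  Relation.ReflTransGen.stdSymm.symm _ _ h

theorem setConnected_of_center {S : Set V} (b : V)
    (h : ∀ a ∈ S, Relation.ReflTransGen (fun x y => x ∈ S ∧ y ∈ S ∧ UAdj E x y) a b) :
    SetConnected E S :=
  fun x hx y hy => (h x hx).trans (reflTransGen_inside_symm (h y hy))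

theorem reflTransGen_inside_reachSet {F : V → V → Prop} {u : V → ℝ}
    (hF : ∀ x y, F x y → Tight E c u x y) {x b : V} (hx : x ∈ reachSet E c F u b) :
    Relation.ReflTransGen
      (fun x y => x ∈ reachSet E c F u b ∧ y ∈ reachSet E c F u b ∧ UAdj E x y) x b := by
  induction hx using Relation.ReflTransGen.head_induction_on with
  | refl => exact .refl
  | head h hyb ih =>
    refine .head ⟨.head h hyb, hyb, ?_⟩ ih
    rcases h with h | h
    · exact Or.inl h.1
    · exact Or.inr (hF _ _ h).1

/-- One maximal step along a circuit. -/
def IsCircuitStep (E : Set (V × V)) (P : Set (V → ℝ)) (u z : V → ℝ) : Prop :=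
  ∃ (g : V → ℝ) (α : ℝ), IsCircuit E g ∧ 0 < α ∧ z = u + α • g ∧
    ∀ β : ℝ, α < β → u + β • g ∉ P

/-- A partition of a connected graph into connected parts, cutting an edge from `R` to its
complement but no active edge in that direction, gives a circuit step. -/
theorem exists_isCircuitStep_of_cut [Finite V] {u : V → ℝ} (hu : u ∈ dualPoly E v₀ c)
    {R : Set V} (hR : SetConnected E R) (hRc : SetConnected E Rᶜ)
    {a b : V} (hab : (a, b) ∈ E) (ha : a ∈ R) (hb : b ∉ R)
    (hcut : ∀ x y, x ∈ R → y ∉ R → ¬ Tight E c u x y) :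
    ∃ z ∈ dualPoly E v₀ c, IsCircuitStep E (dualPoly E v₀ c) u z ∧
      (∀ x y, (x ∈ R ↔ y ∈ R) → -z x + z y = -u x + u y) ∧
      ∃ x y, x ∈ R ∧ y ∉ R ∧ Tight E c z x y := by
  classical
  obtain ⟨e₀, ⟨he₀, he₀R, he₀c⟩, hmin⟩ :=
    (Set.toFinite {e | e ∈ E ∧ e.1 ∈ R ∧ e.2 ∉ R}).exists_minimalFor
      (fun e => c e - (-u e.1 + u e.2)) _ ⟨(a, b), hab, ha, hb⟩
  set α := c e₀ - (-u e₀.1 + u e₀.2) with hα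
  have hmin' : ∀ e ∈ E, e.1 ∈ R → e.2 ∉ R → α ≤ c e - (-u e.1 + u e.2) := by
    intro e he h1 h2
    by_contra hlt
    exact hlt (hmin ⟨he, h1, h2⟩ (not_le.1 hlt).le)
  have hα0 : 0 < α :=
    sub_pos.2 (lt_of_le_of_ne (hu.2 e₀ he₀) fun h => hcut _ _ he₀R he₀c ⟨he₀, h⟩)
  obtain ⟨g, hg, hg0, hgdiff⟩ : ∃ g : V → ℝ, IsCircuit E g ∧ g v₀ = 0 ∧
      ∀ x y, -g x + g y = (if x ∈ R then 1 else 0) - (if y ∈ R then 1 else 0) := by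
    by_cases h0 : v₀ ∈ R
    · refine ⟨Rᶜ.indicator 1, ⟨Rᶜ, ⟨b, hb⟩, ⟨a, by simpa⟩, hRc, by simpa, Or.inl rfl⟩,
        by simp [h0], fun x y => ?_⟩
      by_cases hx : x ∈ R <;> by_cases hy : y ∈ R <;> simp [hx, hy]
    · refine ⟨-R.indicator 1, ⟨R, ⟨a, ha⟩, ⟨b, hb⟩, hR, hRc, Or.inr rfl⟩,
        by simp [h0], fun x y => ?_⟩
      by_cases hx : x ∈ R <;> by_cases hy : y ∈ R <;> simp [hx, hy]
  have hdiff : ∀ (t : ℝ) (x y : V), -(u + t • g) x + (u + t • g) y =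
      -u x + u y + t * ((if x ∈ R then 1 else 0) - (if y ∈ R then 1 else 0)) := by
    intro t x y
    rw [← hgdiff]
    simp only [Pi.add_apply, Pi.smul_apply, smul_eq_mul]
    ring
  refine ⟨u + α • g, ⟨by simp [hu.1, hg0], fun e he => ?_⟩,
    ⟨g, α, hg, hα0, rfl, fun β hβ hmem => ?_⟩, fun x y hxy => ?_,
    e₀.1, e₀.2, he₀R, he₀c, he₀, ?_⟩
  · have h1 := hu.2 e he
    have h2 := hmin' e he
    rw [hdiff]
    by_cases hx : e.1 ∈ R <;> by_cases hy : e.2 ∈ R <;> simp only [hx, hy, if_true, if_false]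
    · linarith
    · linarith [h2 hx hy]
    · linarith
    · linarith
  · have h1 := hmem.2 e₀ he₀
    rw [hdiff] at h1
    simp only [he₀R, he₀c, if_true, if_false] at h1
    linarith
  · rw [hdiff]
    simp [hxy]
  · rw [hdiff]
    simp only [he₀R, he₀c, if_true, if_false, hα]
    ring

/-- If `a` does not reach `b`, a circuit step keeps the `F`-edges active and enlarges the set of
nodes reaching `b`. -/
theorem exists_isCircuitStep_reachSet_ssubset [Finite V] (hconn : UConnected E) {u : V → ℝ}
    (hu : u ∈ dualPoly E v₀ c) {F : V → V → Prop} (hF : ∀ x y, F x y → Tight E c u x y)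
    {a b : V} (hab : (a, b) ∈ E) (ha : a ∉ reachSet E c F u b) :
    ∃ z ∈ dualPoly E v₀ c, IsCircuitStep E (dualPoly E v₀ c) u z ∧
      (∀ x y, F x y → Tight E c z x y) ∧ reachSet E c F u b ⊂ reachSet E c F z b := by
  set S := reachSet E c F u b with hS
  set R : Set V := {x | Relation.ReflTransGen (fun x y => x ∈ Sᶜ ∧ y ∈ Sᶜ ∧ UAdj E x y) x a}
    with hRdef
  have hRS : ∀ x ∈ R, x ∉ S := by
    intro x hx
    rcases Relation.ReflTransGen.cases_head hx with h | ⟨y, h, -⟩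
    · exact h ▸ ha
    · exact h.1
  have hadj : ∀ x y, y ∈ R → x ∉ R → UAdj E x y → x ∈ S := by
    intro x y hy hx hxy
    by_contra hxS
    exact hx (.head ⟨hxS, hRS y hy, hxy⟩ hy)
  have hb : b ∉ R := fun h => hRS b h (mem_reachSet_self F u b)
  have hRconn : SetConnected E R := by
    refine setConnected_of_center a fun x hx => ?_
    have hx' : Relation.ReflTransGen (fun x y => x ∈ Sᶜ ∧ y ∈ Sᶜ ∧ UAdj E x y) x a := hx
    induction hx' using Relation.ReflTransGen.head_induction_on with
    | refl => exact .refl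
    | head h hya ih => exact .head ⟨.head h hya, hya, h.2.2⟩ (ih hya)
  have hSRc : ∀ x ∈ S, Relation.ReflTransGen
      (fun x y => x ∈ Rᶜ ∧ y ∈ Rᶜ ∧ UAdj E x y) x b := fun x hx =>
    Relation.ReflTransGen.mono
      (fun p q h => ⟨fun hp => hRS p hp h.1, fun hq => hRS q hq h.2.1, h.2.2⟩)
      _ _ (reflTransGen_inside_reachSet hF hx)
  have hRcconn : SetConnected E Rᶜ := by
    refine setConnected_of_center b fun x hx => ?_
    have hxb := hconn x b
    induction hxb using Relation.ReflTransGen.head_induction_on with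
    | refl => exact .refl
    | @head x y h _ ih =>
      by_cases hy : y ∈ R
      · exact hSRc x (hadj x y hy hx h)
      · exact .head ⟨hx, hy, h⟩ (ih hy)
  have hRS' : ∀ x y, x ∈ R → y ∉ R → UAdj E x y → y ∈ S := fun x y hx hy h =>
    hadj y x hx hy (uAdj_symm h)
  obtain ⟨z, hz, hstep, hsame, x, y, hx, hy, hxy⟩ :=
    exists_isCircuitStep_of_cut hu hRconn hRcconn hab Relation.ReflTransGen.refl hb
      fun x y hx hy h => hRS x hx (mem_reachSet_of_tight h (hRS' x y hx hy (Or.inl h.1)))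
  have hFz : ∀ x y, F x y → Tight E c z x y := by
    intro x y h
    have hE := (hF x y h).1
    refine ⟨hE, (hsame x y ?_).trans (hF x y h).2⟩
    have hiff := mem_reachSet_iff_of_rel hF (b := b) h
    constructor <;> intro h1 <;> by_contra h2
    · exact hRS x h1 (hiff.2 (hRS' x y h1 h2 (Or.inl hE)))
    · exact hRS y h1 (hiff.1 (hadj x y h1 h2 (Or.inl hE)))
  have hsub : S ⊆ reachSet E c F z b := by
    intro p hp
    have hp' : Relation.ReflTransGen (fun x y => Tight E c u x y ∨ F y x) p b := hp
    induction hp' using Relation.ReflTransGen.head_induction_on with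
    | refl => exact mem_reachSet_self F z b
    | @head p q h hq ih =>
      refine .head ?_ (ih hq)
      refine h.imp_left fun h => ⟨h.1, (hsame p q ?_).trans h.2⟩
      exact iff_of_false (fun h' => hRS p h' hp) (fun h' => hRS q h' hq)
  refine ⟨z, hz, hstep, hFz, hsub, fun hsup => hRS x hx (hsup ?_)⟩
  exact mem_reachSet_of_tight hxy (hsub (hRS' x y hx hy (Or.inl hxy.1)))

/-- If `a` reaches `b` then `(a, b)` is active whenever it is active at a feasible `v` at which
the `F`-edges are active. -/
theorem tight_of_mem_reachSet {u v : V → ℝ} (hu : u ∈ dualPoly E v₀ c)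
    (hv : v ∈ dualPoly E v₀ c) {F : V → V → Prop} (hF : ∀ x y, F x y → Tight E c u x y)
    (hFv : ∀ x y, F x y → Tight E c v x y) {a b : V} (hab : Tight E c v a b)
    (ha : a ∈ reachSet E c F u b) : Tight E c u a b := by
  have key : ∀ x, x ∈ reachSet E c F u b → u x - v x ≤ u b - v b := by
    intro x hx
    induction hx using Relation.ReflTransGen.head_induction_on with
    | refl => exact le_rfl
    | @head x y h _ ih =>
      refine le_trans ?_ ih
      rcases h with h | h
      · have h1 := h.2
        have h2 := hv.2 _ h.1
        dsimp only at h2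
        linarith
      · have h1 := (hF _ _ h).2
        have h2 := (hFv _ _ h).2
        linarith
  have h1 := key a ha
  have h2 := hu.2 _ hab.1
  have h3 := hab.2
  dsimp only at h2
  exact ⟨hab.1, le_antisymm h2 (by linarith)⟩

/-- `y` is reached from `u` by a circuit walk of length `n`. -/
def HasCircuitWalk (E : Set (V × V)) (P : Set (V → ℝ)) (n : ℕ) (u y : V → ℝ) : Prop :=
  ∃ w : Fin (n + 1) → V → ℝ, IsCircuitWalk E P w ∧ w 0 = u ∧ w (Fin.last n) = y

theorem HasCircuitWalk.refl {P : Set (V → ℝ)} {u : V → ℝ} (hu : u ∈ P) :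
    HasCircuitWalk E P 0 u u :=
  ⟨fun _ => u, ⟨fun _ => hu, fun i => i.elim0⟩, rfl, rfl⟩

theorem HasCircuitWalk.cons {P : Set (V → ℝ)} {n : ℕ} {u z y : V → ℝ} (hu : u ∈ P)
    (hstep : IsCircuitStep E P u z) (h : HasCircuitWalk E P n z y) :
    HasCircuitWalk E P (n + 1) u y := by
  obtain ⟨w, ⟨hmem, hw⟩, rfl, rfl⟩ := h
  refine ⟨Fin.cons u w, ⟨fun i => ?_, fun i => ?_⟩, rfl, ?_⟩
  · cases i using Fin.cases with
    | zero => exact hu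
    | succ j => exact hmem j
  · cases i using Fin.cases with
    | zero => exact hstep
    | succ j => exact hw j
  · rw [← Fin.succ_last, Fin.cons_succ]

/-- Adding a relation between distinct classes lowers the number of classes. -/
theorem card_quot_sup_lt [Finite V] {F : V → V → Prop} {a b : V}
    (hne : Quot.mk F a ≠ Quot.mk F b) :
    Nat.card (Quot fun x y => F x y ∨ (x = a ∧ y = b)) < Nat.card (Quot F) := by
  set F' : V → V → Prop := fun x y => F x y ∨ (x = a ∧ y = b)
  let f : Quot F → Quot F' := Quot.map id fun _ _ h => Or.inl h
  have hf : Function.Surjective f := by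
    rintro ⟨x⟩
    exact ⟨Quot.mk F x, rfl⟩
  refine lt_of_le_of_ne (Nat.card_le_card_of_surjective f hf) fun heq => hne ?_
  have hbij := (Nat.bijective_iff_surjective_and_card f).2 ⟨hf, heq.symm⟩
  exact hbij.1 (Quot.sound (r := F') (Or.inr ⟨rfl, rfl⟩))

theorem exists_hasCircuitWalk [Finite V] (hconn : UConnected E) {v : V → ℝ}
    (hv : v ∈ (dualPoly E v₀ c).extremePoints ℝ) (m : ℕ) (F : V → V → Prop)
    (hFv : ∀ x y, F x y → Tight E c v x y) (hcard : Nat.card (Quot F) ≤ m + 1)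
    {u : V → ℝ} (hu : u ∈ dualPoly E v₀ c) (hF : ∀ x y, F x y → Tight E c u x y) :
    ∃ n, 2 * n ≤ (m + 1) * m ∧ HasCircuitWalk E (dualPoly E v₀ c) n u v := by
  induction m generalizing F u with
  | zero =>
    have hsub : Subsingleton (Quot F) := Finite.card_le_one_iff_subsingleton.1 hcard
    have huv : u = v := by
      have hlift := fun x => congrArg (Quot.lift (fun x => u x - v x) fun p q h => by
        have h1 := (hF p q h).2
        have h2 := (hFv p q h).2
        linarith) (hsub.elim (Quot.mk F x) (Quot.mk F v₀))
      ext x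
      have h1 : u x - v x = u v₀ - v v₀ := hlift x
      rw [hu.1, hv.1.1] at h1
      linarith
    exact ⟨0, by simp, huv ▸ .refl hu⟩
  | succ m ih =>
    by_cases hall : ∀ a b, Tight E c v a b → Quot.mk F a = Quot.mk F b
    · have hsub : Subsingleton (Quot F) := by
        refine ⟨?_⟩
        rintro ⟨x⟩ ⟨y⟩
        exact (eq_of_tight_imp_eq hv _ hall x).trans (eq_of_tight_imp_eq hv _ hall y).symm
      obtain ⟨n, hn, hw⟩ := ih F hFv
        ((Finite.card_le_one_iff_subsingleton.2 hsub).trans (by omega)) hu hF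
      exact ⟨n, hn.trans (by gcongr <;> omega), hw⟩
    push Not at hall
    obtain ⟨a, b, hab, hne⟩ := hall
    have merge : ∀ u ∈ dualPoly E v₀ c, (∀ x y, F x y → Tight E c u x y) →
        a ∈ reachSet E c F u b →
        ∃ n, 2 * n ≤ (m + 1) * m ∧ HasCircuitWalk E (dualPoly E v₀ c) n u v := by
      intro u hu hF ha
      have htight := tight_of_mem_reachSet hu hv.1 hF hFv hab ha
      have := card_quot_sup_lt hne
      exact ih (fun x y => F x y ∨ (x = a ∧ y = b))
        (by rintro x y (h | ⟨rfl, rfl⟩); exacts [hFv _ _ h, hab]) (by omega) hu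
        (by rintro x y (h | ⟨rfl, rfl⟩); exacts [hF _ _ h, htight])
    have inner : ∀ (N : ℕ) (u : V → ℝ), u ∈ dualPoly E v₀ c →
        (∀ x y, F x y → Tight E c u x y) →
        (Quot.mk F '' (reachSet E c F u b)ᶜ).ncard ≤ N →
        ∃ n, 2 * n ≤ 2 * N + (m + 1) * m ∧ HasCircuitWalk E (dualPoly E v₀ c) n u v := by
      intro N
      induction N with
      | zero =>
        intro u hu hF hN
        have ha : a ∈ reachSet E c F u b := by
          by_contra ha
          have : Quot.mk F a ∈ Quot.mk F '' (reachSet E c F u b)ᶜ := ⟨a, ha, rfl⟩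
          rw [(Set.ncard_eq_zero).1 (Nat.le_zero.1 hN)] at this
          exact this
        obtain ⟨n, hn, hw⟩ := merge u hu hF ha
        exact ⟨n, by omega, hw⟩
      | succ N ihN =>
        intro u hu hF hN
        by_cases ha : a ∈ reachSet E c F u b
        · obtain ⟨n, hn, hw⟩ := merge u hu hF ha
          exact ⟨n, by omega, hw⟩
        · obtain ⟨z, hz, hstep, hFz, hss⟩ :=
            exists_isCircuitStep_reachSet_ssubset hconn hu hF hab.1 ha
          have hlt : (Quot.mk F '' (reachSet E c F z b)ᶜ).ncard <
              (Quot.mk F '' (reachSet E c F u b)ᶜ).ncard := by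
            refine Set.ncard_lt_ncard ⟨Set.image_mono (Set.compl_subset_compl.2 hss.1),
              fun hsup => ?_⟩
            obtain ⟨x, hxz, hxu⟩ := Set.exists_of_ssubset hss
            obtain ⟨y, hy, hyx⟩ := hsup ⟨x, hxu, rfl⟩
            exact hy ((mem_reachSet_iff_of_quot_eq hFz hyx).2 hxz)
          obtain ⟨n, hn, hw⟩ := ihN z hz hFz (by omega)
          exact ⟨n + 1, by omega, hw.cons hu hstep⟩
    have hlt : (Quot.mk F '' (reachSet E c F u b)ᶜ).ncard < Nat.card (Quot F) := by
      rw [← Set.ncard_univ]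
      refine Set.ncard_lt_ncard ⟨Set.subset_univ _, fun hsup => ?_⟩
      obtain ⟨y, hy, hyb⟩ := hsup (Set.mem_univ (Quot.mk F b))
      exact hy ((mem_reachSet_iff_of_quot_eq hF hyb).2 (mem_reachSet_self F u b))
    obtain ⟨n, hn, hw⟩ := inner (m + 1) u hu hF (by omega)
    exact ⟨n, by nlinarith, hw⟩

end DualNetworkFlow

/-- **Theorem 3 (Circuit diameter).**
For a directed graph `G = (V, E)` (no self-loops) whose underlying undirected graph is
connected, with distinguished node `v₀` and costs `c`, any two extreme points of the dual
network flow polyhedron `P(G,c)` are joined by a circuit walk of length at most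
`|V| * (|V| - 1) / 2`. -/
theorem circuit_diameter_bound {V : Type*} [Fintype V] (E : Set (V × V))
    (hloop : ∀ e ∈ E, e.1 ≠ e.2) (v₀ : V) (hconn : UConnected E) (c : V × V → ℝ) :
    ∀ u ∈ (dualPoly E v₀ c).extremePoints ℝ,
      ∀ v ∈ (dualPoly E v₀ c).extremePoints ℝ,
        ∃ (n : ℕ) (w : Fin (n + 1) → V → ℝ),
          IsCircuitWalk E (dualPoly E v₀ c) w ∧ w 0 = u ∧ w (Fin.last n) = v ∧
          (n : ℝ) ≤ (Fintype.card V : ℝ) * ((Fintype.card V : ℝ) - 1) / 2 := by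
  intro u hu v hv
  have hpos : 0 < Fintype.card V := Fintype.card_pos_iff.2 ⟨v₀⟩
  obtain ⟨m, hm⟩ := Nat.exists_eq_add_of_lt hpos
  have hcard : Nat.card (Quot fun _ _ : V => False) ≤ m + 1 := by
    have h := Nat.card_le_card_of_surjective (Quot.mk fun _ _ : V => False) Quot.mk_surjective
    rw [Nat.card_eq_fintype_card (α := V)] at h
    omega
  obtain ⟨n, hn, w, hw, h0, h1⟩ := DualNetworkFlow.exists_hasCircuitWalk hconn hv m
    (fun _ _ => False) (fun _ _ h => h.elim) hcard hu.1 (fun _ _ h => h.elim)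
  refine ⟨n, w, hw, h0, h1, ?_⟩
  have hn' : (2 : ℝ) * n ≤ (m + 1) * m := by exact_mod_cast hn
  rw [hm]
  push_cast
  linarith
end

section
/- Let G = (V, E) be a directed graph with distinguished node v₀ and let c : E → ℝ. Let w₀, w₁, …, w_k ∈ V with k ≥ 2 be nodes such that (wᵢ, wᵢ₊₁) ∈ E for all i = 0, …, k−1, and suppose also (w₀, w_k) ∈ E. If there exists a point w ∈ P(G,c) at which the edge (w₀, w_k) is tight, then every point u ∈ P(G,c) at which all the edges (wᵢ, wᵢ₊₁), i = 0, …, k−1, are tight also has the edge (w₀, w_k) tight. -/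
open scoped BigOperators

/-- **Lemma 3.**
Let `p 0, p 1, …, p k` (with `k ≥ 2`) be a directed path in `G` and suppose also
`(p 0, p k) ∈ E`. If there is a point `w ∈ P(G,c)` at which the edge `(p 0, p k)` is tight,
then every point `u ∈ P(G,c)` at which all the path edges `(p i, p (i+1))` are tight also has
the edge `(p 0, p k)` tight. -/
theorem tight_edge_of_tight_path {V : Type*} (E : Set (V × V))
    (hloop : ∀ e ∈ E, e.1 ≠ e.2) (v₀ : V) (c : V × V → ℝ)
    (k : ℕ) (hk : 2 ≤ k) (p : Fin (k + 1) → V)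
    (hpath : ∀ i : Fin k, (p i.castSucc, p i.succ) ∈ E)
    (hE : (p 0, p (Fin.last k)) ∈ E)
    (w : V → ℝ) (hw : w ∈ dualPoly E v₀ c)
    (hwt : -w (p 0) + w (p (Fin.last k)) = c (p 0, p (Fin.last k)))
    (u : V → ℝ) (hu : u ∈ dualPoly E v₀ c)
    (hut : ∀ i : Fin k, -u (p i.castSucc) + u (p i.succ) = c (p i.castSucc, p i.succ)) :
    -u (p 0) + u (p (Fin.last k)) = c (p 0, p (Fin.last k)) := by
  have hanti : Antitone fun i : Fin (k + 1) => w (p i) - u (p i) :=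
    Fin.antitone_iff_succ_le.2 fun i => by
      linarith [hw.2 _ (hpath i), hut i]
  linarith [hanti (Fin.zero_le (Fin.last k)), hu.2 _ hE]
end

section
/- Let G = (V, E) be a directed graph with distinguished node v₀ and let c : E → ℝ. Let a, b ∈ V and let P₁ and P₂ be two directed paths in G from a to b (each given by a sequence of nodes in which every consecutive pair is an edge of E). If there exists a point w ∈ P(G,c) at which every edge of P₁ is tight, then every point u ∈ P(G,c) at which every edge of P₂ is tight also has every edge of P₁ tight. -/
open scoped BigOperators

/-- The increments of a real sequence indexed by `Fin (k + 1)` telescope. -/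
theorem sum_neg_castSucc_add_succ {k : ℕ} (f : Fin (k + 1) → ℝ) :
    ∑ i : Fin k, (-f i.castSucc + f i.succ) = -f 0 + f (Fin.last k) := by
  have h := (Fin.sum_univ_succ f).symm.trans (Fin.sum_univ_castSucc f)
  rw [Finset.sum_add_distrib, Finset.sum_neg_distrib]
  linarith

/-- **Generalization of Lemma 3.**
Let `p₁` and `p₂` be two directed paths in `G` from `a` to `b`. If there is a point
`w ∈ P(G,c)` at which every edge of `p₁` is tight, then every point `u ∈ P(G,c)` at which
every edge of `p₂` is tight also has every edge of `p₁` tight. -/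
theorem tight_path_of_tight_path {V : Type*} (E : Set (V × V))
    (hloop : ∀ e ∈ E, e.1 ≠ e.2) (v₀ : V) (c : V × V → ℝ) (a b : V)
    (k₁ k₂ : ℕ) (p₁ : Fin (k₁ + 1) → V) (p₂ : Fin (k₂ + 1) → V)
    (hp₁a : p₁ 0 = a) (hp₁b : p₁ (Fin.last k₁) = b)
    (hp₂a : p₂ 0 = a) (hp₂b : p₂ (Fin.last k₂) = b)
    (hp₁E : ∀ i : Fin k₁, (p₁ i.castSucc, p₁ i.succ) ∈ E)
    (hp₂E : ∀ i : Fin k₂, (p₂ i.castSucc, p₂ i.succ) ∈ E)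
    (w : V → ℝ) (hw : w ∈ dualPoly E v₀ c)
    (hwt : ∀ i : Fin k₁, -w (p₁ i.castSucc) + w (p₁ i.succ) = c (p₁ i.castSucc, p₁ i.succ))
    (u : V → ℝ) (hu : u ∈ dualPoly E v₀ c)
    (hut : ∀ i : Fin k₂, -u (p₂ i.castSucc) + u (p₂ i.succ) = c (p₂ i.castSucc, p₂ i.succ)) :
    ∀ i : Fin k₁, -u (p₁ i.castSucc) + u (p₁ i.succ) = c (p₁ i.castSucc, p₁ i.succ) := by
  have hu₁ := sum_neg_castSucc_add_succ fun j => u (p₁ j)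
  have hu₂ := sum_neg_castSucc_add_succ fun j => u (p₂ j)
  have hw₁ := sum_neg_castSucc_add_succ fun j => w (p₁ j)
  have hw₂ := sum_neg_castSucc_add_succ fun j => w (p₂ j)
  simp only [hp₁a, hp₁b] at hu₁ hw₁
  simp only [hp₂a, hp₂b] at hu₂ hw₂
  have hle₁ : ∀ i ∈ Finset.univ, -u (p₁ (Fin.castSucc i)) + u (p₁ i.succ) ≤
      -w (p₁ i.castSucc) + w (p₁ i.succ) :=
    fun i _ => (hu.2 _ (hp₁E i)).trans_eq (hwt i).symm
  have hle₂ : ∑ i : Fin k₂, (-w (p₂ i.castSucc) + w (p₂ i.succ)) ≤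
      ∑ i : Fin k₂, (-u (p₂ i.castSucc) + u (p₂ i.succ)) :=
    Finset.sum_le_sum fun i _ => (hw.2 _ (hp₂E i)).trans_eq (hut i).symm
  have hsum := le_antisymm (Finset.sum_le_sum hle₁) (by linarith)
  intro i
  exact ((Finset.sum_eq_sum_iff_of_le hle₁).1 hsum i (Finset.mem_univ i)).trans (hwt i)
end

section
/- Let Gᵢ = (Vᵢ, Eᵢ), i = 1, …, k, be directed graphs, each connected in its underlying undirected graph, with distinguished nodes v₀ⁱ and costs cⁱ : Eᵢ → ℝ, and suppose the dual network flow polyhedron P(Gᵢ, cⁱ) has circuit diameter at least dᵢ for each i. Let G = (V, E) with costs c be the graph obtained by glueing G₁, …, G_k together at the nodes v₀ⁱ. Then P(G,c) has circuit diameter at least d₁ + d₂ + ⋯ + d_k; that is, there exist two extreme points of P(G,c) such that every circuit walk from one to the other has length at least d₁ + ⋯ + d_k. -/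
open scoped BigOperators

section Glueing

variable {k : ℕ}

/-- Node set of the graph obtained by glueing the graphs on node sets `Vf i` together at the
distinguished nodes `v₀ i`; the glued node `v₀` is `none`. -/
abbrev GluedV (Vf : Fin k → Type*) (v₀ : ∀ i, Vf i) : Type _ :=
  Option (Σ i : Fin k, {x : Vf i // x ≠ v₀ i})

/-- The canonical map from the node set of component `i` into the glued node set,
sending `v₀ i` to the glued node `none`. -/
def glueMap {Vf : Fin k → Type*} [∀ i, DecidableEq (Vf i)] (v₀ : ∀ i, Vf i) (i : Fin k)
    (x : Vf i) : GluedV Vf v₀ :=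
  if h : x = v₀ i then none else some ⟨i, ⟨x, h⟩⟩

/-- Edge set of the glued graph: the disjoint union of the edge sets `Ef i`, with every
occurrence of `v₀ i` replaced by the glued node. -/
def GluedE {Vf : Fin k → Type*} [∀ i, DecidableEq (Vf i)] (Ef : ∀ i, Set (Vf i × Vf i))
    (v₀ : ∀ i, Vf i) : Set (GluedV Vf v₀ × GluedV Vf v₀) :=
  ⋃ i, (fun e : Vf i × Vf i => (glueMap v₀ i e.1, glueMap v₀ i e.2)) '' (Ef i)

end Glueing

section CircuitWalk

variable {V : Type*} {E : Set (V × V)} {P : Set (V → ℝ)}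

/-- A single maximal circuit step from `x` to `y`. -/
def IsCircuitStep (E : Set (V × V)) (P : Set (V → ℝ)) (x y : V → ℝ) : Prop :=
  ∃ (g : V → ℝ) (α : ℝ), IsCircuit E g ∧ 0 < α ∧
    y = x + α • g ∧ ∀ β : ℝ, α < β → x + β • g ∉ P

/-- There is a circuit walk of length `n` from `x` to `y`. -/
def HasCircuitWalk (E : Set (V × V)) (P : Set (V → ℝ)) (n : ℕ) (x y : V → ℝ) : Prop :=
  ∃ w : Fin (n + 1) → V → ℝ, IsCircuitWalk E P w ∧ w 0 = x ∧ w (Fin.last n) = y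

theorem HasCircuitWalk.refl {x : V → ℝ} (hx : x ∈ P) : HasCircuitWalk E P 0 x x :=
  ⟨fun _ => x, ⟨fun _ => hx, fun i => i.elim0⟩, rfl, rfl⟩

theorem HasCircuitWalk.snoc {n : ℕ} {x y z : V → ℝ} (h : HasCircuitWalk E P n x y)
    (hz : z ∈ P) (hs : IsCircuitStep E P y z) : HasCircuitWalk E P (n + 1) x z := by
  obtain ⟨w, ⟨hP, hw⟩, rfl, rfl⟩ := h
  refine ⟨Fin.snoc (α := fun _ => V → ℝ) w z, ⟨fun i => ?_, fun i => ?_⟩, ?_, ?_⟩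
  · induction i using Fin.lastCases with
    | last => simpa using hz
    | cast i => simpa using hP i
  · induction i using Fin.lastCases with
    | last =>
      rw [Fin.succ_last, Fin.snoc_last, Fin.snoc_castSucc]
      exact hs
    | cast i =>
      rw [Fin.succ_castSucc, Fin.snoc_castSucc, Fin.snoc_castSucc]
      exact hw i
  · rw [← Fin.castSucc_zero, Fin.snoc_castSucc]
  · simp

/-- The image of a connected set under a map sending edges to edges or points is connected. -/
theorem SetConnected.of_map {W : Type*} {F : Set (W × W)} {S : Set V} {T : Set W}
    (hS : SetConnected E S) (r : V → W) (g : W → V) (hr : ∀ x ∈ S, r x ∈ T)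
    (hg : ∀ y ∈ T, g y ∈ S) (hrg : ∀ y, r (g y) = y)
    (hE : ∀ a b, UAdj E a b → r a = r b ∨ UAdj F (r a) (r b)) : SetConnected F T := by
  intro a ha b hb
  have h := hS (g a) (hg a ha) (g b) (hg b hb)
  rw [← hrg a, ← hrg b]
  generalize g b = b' at h ⊢
  induction h with
  | refl => exact .refl
  | tail _ hxy ih =>
    obtain ⟨hx, hy, hadj⟩ := hxy
    rcases hE _ _ hadj with h | h
    · rwa [← h]
    · exact ih.tail ⟨hr _ hx, hr _ hy, h⟩

end CircuitWalk

section GlueLemmas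

variable {k : ℕ} {Vf : Fin k → Type*} [∀ i, DecidableEq (Vf i)] {v₀ : ∀ i, Vf i}
  {Ef : ∀ i, Set (Vf i × Vf i)}

@[simp]
theorem glueMap_base (i : Fin k) : glueMap v₀ i (v₀ i) = none := by
  simp [glueMap]

theorem glueMap_of_ne {i : Fin k} {x : Vf i} (h : x ≠ v₀ i) :
    glueMap v₀ i x = some ⟨i, ⟨x, h⟩⟩ := by
  simp [glueMap, h]

/-- The retraction of the glued node set onto component `i`, collapsing all other components. -/
def glueRetract (v₀ : ∀ i, Vf i) (i : Fin k) : GluedV Vf v₀ → Vf i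
  | none => v₀ i
  | some ⟨j, x⟩ => Function.update v₀ j x.1 i

@[simp]
theorem glueRetract_glueMap_self (i : Fin k) (x : Vf i) :
    glueRetract v₀ i (glueMap v₀ i x) = x := by
  by_cases h : x = v₀ i
  · subst h; simp [glueRetract]
  · simp [glueMap_of_ne h, glueRetract]

theorem glueRetract_glueMap_of_ne {i j : Fin k} (hij : i ≠ j) (x : Vf j) :
    glueRetract v₀ i (glueMap v₀ j x) = v₀ i := by
  by_cases h : x = v₀ j
  · subst h; simp [glueRetract]
  · simp [glueMap_of_ne h, glueRetract, hij]

theorem glueRetract_adj (i : Fin k) {a b : GluedV Vf v₀} (h : UAdj (GluedE Ef v₀) a b) :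
    glueRetract v₀ i a = glueRetract v₀ i b ∨
      UAdj (Ef i) (glueRetract v₀ i a) (glueRetract v₀ i b) := by
  simp only [UAdj, GluedE, Set.mem_iUnion, Set.mem_image, Prod.mk.injEq] at h
  rcases h with ⟨j, e, he, rfl, rfl⟩ | ⟨j, e, he, rfl, rfl⟩ <;> by_cases hij : i = j
  · subst hij; right; left; simpa using he
  · left; simp [glueRetract_glueMap_of_ne hij]
  · subst hij; right; right; simpa using he
  · left; simp [glueRetract_glueMap_of_ne hij]

/-- An edge leaving a non-base node of component `i` stays in component `i`. -/
theorem mem_range_glueMap_of_adj {i : Fin k} {a b : GluedV Vf v₀}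
    (h : UAdj (GluedE Ef v₀) a b) (ha : a ≠ none) (hai : a ∈ Set.range (glueMap v₀ i)) :
    b ∈ Set.range (glueMap v₀ i) := by
  have key : ∀ (j : Fin k) (x y : Vf j), glueMap v₀ j x ≠ none →
      glueMap v₀ j x ∈ Set.range (glueMap v₀ i) → glueMap v₀ j y ∈ Set.range (glueMap v₀ i) := by
    rintro j x y hx ⟨z, hz⟩
    have hij : i = j := by
      by_contra hij
      have hz' := congrArg (glueRetract v₀ i) hz
      rw [glueRetract_glueMap_self, glueRetract_glueMap_of_ne hij] at hz'
      subst hz'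
      exact hx (by rw [← hz, glueMap_base])
    subst hij
    exact ⟨y, rfl⟩
  simp only [UAdj, GluedE, Set.mem_iUnion, Set.mem_image, Prod.mk.injEq] at h
  rcases h with ⟨j, e, -, rfl, rfl⟩ | ⟨j, e, -, rfl, rfl⟩
  · exact key j _ _ ha hai
  · exact key j _ _ ha hai

/-- A connected node set avoiding the glued node lies in a single component. -/
theorem SetConnected.subset_range_glueMap {S : Set (GluedV Vf v₀)} (hne : S.Nonempty)
    (h0 : none ∉ S) (hS : SetConnected (GluedE Ef v₀) S) :
    ∃ i, S ⊆ Set.range (glueMap v₀ i) := by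
  obtain ⟨s, hs⟩ := hne
  obtain _ | ⟨i, x, hx⟩ := s
  · exact absurd hs h0
  refine ⟨i, fun t ht => ?_⟩
  have h := hS _ hs t ht
  clear ht
  induction h with
  | refl => exact ⟨x, glueMap_of_ne hx⟩
  | tail _ hab ih =>
    exact mem_range_glueMap_of_adj hab.2.2 (fun h => h0 (h ▸ hab.1)) ih

theorem mem_dualPoly_glued {c : GluedV Vf v₀ × GluedV Vf v₀ → ℝ} {cf : ∀ i, Vf i × Vf i → ℝ}
    (hc : ∀ i, ∀ e ∈ Ef i, c (glueMap v₀ i e.1, glueMap v₀ i e.2) = cf i e)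
    {x : GluedV Vf v₀ → ℝ} :
    x ∈ dualPoly (GluedE Ef v₀) none c ↔
      x none = 0 ∧ ∀ i, x ∘ glueMap v₀ i ∈ dualPoly (Ef i) (v₀ i) (cf i) := by
  constructor
  · rintro ⟨h0, h⟩
    refine ⟨h0, fun i => ⟨by simpa using h0, fun e he => ?_⟩⟩
    rw [← hc i e he]
    exact h _ (Set.mem_iUnion.2 ⟨i, e, he, rfl⟩)
  · rintro ⟨h0, h⟩
    refine ⟨h0, fun e he => ?_⟩
    obtain ⟨i, e, he', rfl⟩ := Set.mem_iUnion.1 he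
    simpa only [hc i e he', Function.comp_apply] using (h i).2 e he'

theorem funext_glueMap {x y : GluedV Vf v₀ → ℝ} (h0 : x none = y none)
    (h : ∀ i, x ∘ glueMap v₀ i = y ∘ glueMap v₀ i) : x = y := by
  funext t
  obtain _ | ⟨i, t, ht⟩ := t
  · exact h0
  · rw [← glueMap_of_ne ht]
    exact congrFun (h i) t

/-- Extreme points of the components assemble to an extreme point of the glued polyhedron. -/
theorem exists_extremePoint_glued {c : GluedV Vf v₀ × GluedV Vf v₀ → ℝ}
    {cf : ∀ i, Vf i × Vf i → ℝ}
    (hc : ∀ i, ∀ e ∈ Ef i, c (glueMap v₀ i e.1, glueMap v₀ i e.2) = cf i e)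
    {u : ∀ i, Vf i → ℝ} (hu : ∀ i, u i ∈ (dualPoly (Ef i) (v₀ i) (cf i)).extremePoints ℝ) :
    ∃ x ∈ (dualPoly (GluedE Ef v₀) (none : GluedV Vf v₀) c).extremePoints ℝ,
      ∀ i, x ∘ glueMap v₀ i = u i := by
  let x : GluedV Vf v₀ → ℝ := fun t => t.elim 0 fun p => u p.1 p.2.1
  have hx : ∀ i, x ∘ glueMap v₀ i = u i := by
    intro i
    funext t
    by_cases h : t = v₀ i
    · subst h; simpa [x] using (hu i).1.1.symm
    · simp [x, glueMap_of_ne h]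
  refine ⟨x, ⟨(mem_dualPoly_glued hc).2 ⟨rfl, fun i => hx i ▸ (hu i).1⟩, ?_⟩, hx⟩
  intro y hy z hz hxyz
  rw [mem_dualPoly_glued hc] at hy hz
  refine funext_glueMap hy.1 fun i => ?_
  rw [hx i]
  refine (hu i).2 (hy.2 i) (hz.2 i) ?_
  obtain ⟨a, b, ha, hb, hab, h⟩ := hxyz
  refine ⟨a, b, ha, hb, hab, ?_⟩
  rw [← hx i, ← h]
  rfl

/-- A circuit vanishing at the glued node is a circuit of one component and zero on the others. -/
theorem IsCircuit.exists_component {g : GluedV Vf v₀ → ℝ} (hg : IsCircuit (GluedE Ef v₀) g)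
    (h0 : g none = 0) :
    ∃ i, IsCircuit (Ef i) (g ∘ glueMap v₀ i) ∧ ∀ j, j ≠ i → g ∘ glueMap v₀ j = 0 := by
  obtain ⟨S, hne, -, hS, hSc, hgS⟩ := hg
  have h0S : none ∉ S := by
    intro h
    rcases hgS with rfl | rfl <;> simp [h] at h0
  obtain ⟨i, hi⟩ := hS.subset_range_glueMap hne h0S
  have hret : ∀ t ∈ S, glueMap v₀ i (glueRetract v₀ i t) = t := by
    intro t ht
    obtain ⟨x, rfl⟩ := hi ht
    rw [glueRetract_glueMap_self]
  have hretc : ∀ t ∉ S, glueMap v₀ i (glueRetract v₀ i t) ∉ S := by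
    intro t ht h
    obtain _ | ⟨j, x, hx⟩ := t
    · exact h0S (by simpa [glueRetract] using h)
    · rw [← glueMap_of_ne hx] at ht h
      by_cases hij : i = j
      · subst hij; exact ht (by simpa using h)
      · rw [glueRetract_glueMap_of_ne hij, glueMap_base] at h
        exact h0S h
  refine ⟨i, ⟨glueMap v₀ i ⁻¹' S, ?_, ⟨v₀ i, by simpa using h0S⟩, ?_, ?_, ?_⟩, ?_⟩
  · obtain ⟨s, hs⟩ := hne
    obtain ⟨x, rfl⟩ := hi hs
    exact ⟨x, hs⟩
  · exact hS.of_map (glueRetract v₀ i) (glueMap v₀ i) (fun x hx => by simpa [hret x hx] using hx)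
      (fun y hy => hy) (glueRetract_glueMap_self i) fun a b => glueRetract_adj i
  · exact hSc.of_map (glueRetract v₀ i) (glueMap v₀ i) hretc
      (fun y hy => hy) (glueRetract_glueMap_self i) fun a b => glueRetract_adj i
  · rcases hgS with rfl | rfl
    · left; rfl
    · right; rfl
  · intro j hj
    have hjS : ∀ x, glueMap v₀ j x ∉ S := by
      intro x hx
      have h := hret _ hx
      rw [glueRetract_glueMap_of_ne hj.symm, glueMap_base] at h
      exact h0S (h ▸ hx)
    funext x
    rcases hgS with rfl | rfl <;> simp [hjS x]

/-- A circuit step in the glued polyhedron is a circuit step in one component and stationary in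
all others. -/
theorem IsCircuitStep.exists_component {c : GluedV Vf v₀ × GluedV Vf v₀ → ℝ}
    {cf : ∀ i, Vf i × Vf i → ℝ}
    (hc : ∀ i, ∀ e ∈ Ef i, c (glueMap v₀ i e.1, glueMap v₀ i e.2) = cf i e)
    {x y : GluedV Vf v₀ → ℝ} (hx : x ∈ dualPoly (GluedE Ef v₀) none c)
    (hy : y ∈ dualPoly (GluedE Ef v₀) none c)
    (h : IsCircuitStep (GluedE Ef v₀) (dualPoly (GluedE Ef v₀) none c) x y) :
    ∃ i, IsCircuitStep (Ef i) (dualPoly (Ef i) (v₀ i) (cf i))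
        (x ∘ glueMap v₀ i) (y ∘ glueMap v₀ i) ∧
      ∀ j, j ≠ i → y ∘ glueMap v₀ j = x ∘ glueMap v₀ j := by
  obtain ⟨g, α, hg, hα, rfl, hmax⟩ := h
  have hg0 : g none = 0 := by
    have h1 := hy.1
    have h2 := hx.1
    simpa [h2, hα.ne'] using h1
  obtain ⟨i, hi, hj⟩ := hg.exists_component hg0
  have hcomp : ∀ (β : ℝ) (j : Fin k), j ≠ i →
      (x + β • g) ∘ glueMap v₀ j = x ∘ glueMap v₀ j := by
    intro β j hji
    funext t
    have := congrFun (hj j hji) t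
    simp only [Function.comp_apply, Pi.zero_apply] at this
    simp [this]
  refine ⟨i, ⟨g ∘ glueMap v₀ i, α, hi, hα, rfl, fun β hβ hmem => hmax β hβ ?_⟩, hcomp α⟩
  rw [mem_dualPoly_glued hc] at hx ⊢
  refine ⟨by simp [hx.1, hg0], fun j => ?_⟩
  by_cases hji : j = i
  · subst hji; exact hmem
  · rw [hcomp β j hji]; exact hx.2 j

/-- A circuit walk in the glued polyhedron splits into circuit walks in the components whose
lengths add up to the length of the given walk. -/
theorem IsCircuitWalk.exists_components {c : GluedV Vf v₀ × GluedV Vf v₀ → ℝ}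
    {cf : ∀ i, Vf i × Vf i → ℝ}
    (hc : ∀ i, ∀ e ∈ Ef i, c (glueMap v₀ i e.1, glueMap v₀ i e.2) = cf i e)
    {n : ℕ} {w : Fin (n + 1) → GluedV Vf v₀ → ℝ}
    (hw : IsCircuitWalk (GluedE Ef v₀) (dualPoly (GluedE Ef v₀) none c) w) (t : Fin (n + 1)) :
    ∃ m : Fin k → ℕ, ∑ i, m i = t ∧ ∀ i, HasCircuitWalk (Ef i) (dualPoly (Ef i) (v₀ i) (cf i))
      (m i) (w 0 ∘ glueMap v₀ i) (w t ∘ glueMap v₀ i) := by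
  have hP := fun t i => ((mem_dualPoly_glued hc).1 (hw.1 t)).2 i
  induction t using Fin.induction with
  | zero => exact ⟨0, by simp, fun i => .refl (hP 0 i)⟩
  | succ t ih =>
    obtain ⟨m, hm, hmw⟩ := ih
    obtain ⟨i, hi, hj⟩ := IsCircuitStep.exists_component hc (hw.1 _) (hw.1 _) (hw.2 t)
    refine ⟨m + Pi.single i 1, by simp [Finset.sum_add_distrib, hm], fun j => ?_⟩
    by_cases hji : j = i
    · subst hji
      simpa using (hmw j).snoc (hP _ j) hi
    · simpa [hji, hj j hji] using hmw j

end GlueLemmas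

/-- **Lemma 4 (Glueing, circuit diameter lower bound).**
If for each `i` the dual network flow polyhedron of the connected graph `Gᵢ` has circuit
diameter at least `d i` (witnessed by a pair of extreme points all of whose connecting
circuit walks have length at least `d i`), then the dual network flow polyhedron of the
glued graph has circuit diameter at least `∑ i, d i`: there are two extreme points such
that every circuit walk from one to the other has length at least `∑ i, d i`. -/
theorem glueing_circuit_diameter_lower_bound {k : ℕ} (Vf : Fin k → Type*)
    [∀ i, Fintype (Vf i)] [∀ i, DecidableEq (Vf i)] (Ef : ∀ i, Set (Vf i × Vf i))
    (hloop : ∀ i, ∀ e ∈ Ef i, e.1 ≠ e.2) (v₀ : ∀ i, Vf i)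
    (hconn : ∀ i, UConnected (Ef i)) (cf : ∀ i, Vf i × Vf i → ℝ) (d : Fin k → ℕ)
    (hdiam : ∀ i, ∃ u ∈ (dualPoly (Ef i) (v₀ i) (cf i)).extremePoints ℝ,
      ∃ v ∈ (dualPoly (Ef i) (v₀ i) (cf i)).extremePoints ℝ,
        ∀ (n : ℕ) (w : Fin (n + 1) → Vf i → ℝ),
          IsCircuitWalk (Ef i) (dualPoly (Ef i) (v₀ i) (cf i)) w →
            w 0 = u → w (Fin.last n) = v → d i ≤ n)
    (c : GluedV Vf v₀ × GluedV Vf v₀ → ℝ)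
    (hc : ∀ i, ∀ e ∈ Ef i, c (glueMap v₀ i e.1, glueMap v₀ i e.2) = cf i e) :
    ∃ u ∈ (dualPoly (GluedE Ef v₀) (none : GluedV Vf v₀) c).extremePoints ℝ,
      ∃ v ∈ (dualPoly (GluedE Ef v₀) (none : GluedV Vf v₀) c).extremePoints ℝ,
        ∀ (n : ℕ) (w : Fin (n + 1) → GluedV Vf v₀ → ℝ),
          IsCircuitWalk (GluedE Ef v₀) (dualPoly (GluedE Ef v₀) (none : GluedV Vf v₀) c) w →
            w 0 = u → w (Fin.last n) = v → ∑ i, d i ≤ n := by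
  choose u hu v hv hd using hdiam
  obtain ⟨x, hx, hxu⟩ := exists_extremePoint_glued hc hu
  obtain ⟨y, hy, hyv⟩ := exists_extremePoint_glued hc hv
  refine ⟨x, hx, y, hy, ?_⟩
  rintro n w hw rfl rfl
  obtain ⟨m, hm, hmw⟩ := hw.exists_components hc (Fin.last n)
  rw [Fin.val_last] at hm
  rw [← hm]
  refine Finset.sum_le_sum fun i _ => ?_
  obtain ⟨w', hw', h0, h1⟩ := hmw i
  exact hd i (m i) w' hw' (h0.trans (hxu i)) (h1.trans (hyv i))
end

section
/- Let G₄ be the directed graph on nodes {v₀, v₁, v₂, v₃} with the costs c given in the context and distinguished node v₀. Then u¹ = (0, 0, 0, 0) and u² = (0, 2/3, 4/3, 2) are extreme points of P(G₄, c), and every circuit walk from u¹ to u² has length at least 4; in particular the circuit diameter of P(G₄, c) is at least 4 = |V|. -/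
open scoped BigOperators

/-- The edge set of the graph `G₄` of Example 1, on nodes `v₀ = 0, v₁ = 1, v₂ = 2, v₃ = 3`. -/
def exampleE : Set (Fin 4 × Fin 4) :=
  {(3, 0), (2, 0), (3, 1), (0, 3), (0, 2), (1, 3), (0, 1), (1, 2), (2, 3)}

/-- The costs of the graph `G₄` of Example 1. -/
noncomputable def exampleC : Fin 4 × Fin 4 → ℝ := fun p =>
  if p = (3, 0) then 0 else if p = (2, 0) then 0 else if p = (3, 1) then 0
  else if p = (0, 3) then 2 else if p = (0, 2) then 4 / 3 else if p = (1, 3) then 4 / 3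
  else if p = (0, 1) then 1 else if p = (1, 2) then 1 else if p = (2, 3) then 10 / 9 else 0

open Filter Topology

section TightArcs

variable {V : Type*} {E : Set (V × V)} {v₀ : V} {c : V × V → ℝ}

/-- A feasible point that is determined by its tight arcs is an extreme point. -/
theorem mem_extremePoints_dualPoly_of_tight {x : V → ℝ} (hx : x ∈ dualPoly E v₀ c)
    (h : ∀ y ∈ dualPoly E v₀ c,
      (∀ e ∈ E, -x e.1 + x e.2 = c e → -y e.1 + y e.2 = c e) → y = x) :
    x ∈ (dualPoly E v₀ c).extremePoints ℝ := by
  rw [mem_extremePoints_iff_left]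
  refine ⟨hx, fun y hy z hz ⟨a, b, ha, hb, hab, hxyz⟩ => h y hy fun e he ht => ?_⟩
  have h₁ := congrFun hxyz e.1
  have h₂ := congrFun hxyz e.2
  simp only [Pi.add_apply, Pi.smul_apply, smul_eq_mul] at h₁ h₂
  obtain rfl : b = 1 - a := by linarith
  refine le_antisymm (hy.2 e he) (le_of_mul_le_mul_left ?_ ha)
  linarith [mul_le_mul_of_nonneg_left (hz.2 e he) hb.le]

/-- If every arc that is tight at `y` is nonincreasing along `g`, then one can move from `y`
a little further along `g`. -/
theorem eventually_add_smul_mem_dualPoly (hE : E.Finite) {y g : V → ℝ}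
    (hy : y ∈ dualPoly E v₀ c) (hg₀ : g v₀ = 0)
    (hg : ∀ e ∈ E, -y e.1 + y e.2 = c e → -g e.1 + g e.2 ≤ 0) :
    ∀ᶠ t : ℝ in 𝓝[>] 0, y + t • g ∈ dualPoly E v₀ c := by
  have key : ∀ e ∈ E, ∀ᶠ t : ℝ in 𝓝[>] 0, -(y + t • g) e.1 + (y + t • g) e.2 ≤ c e := by
    intro e he
    simp only [Pi.add_apply, Pi.smul_apply, smul_eq_mul]
    rcases (hy.2 e he).eq_or_lt with ht | ht
    · filter_upwards [self_mem_nhdsWithin] with t (h_pos : 0 < t)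
      linarith [mul_nonneg h_pos.le (neg_nonneg.2 (hg e he ht))]
    · have hc : ContinuousAt (fun t : ℝ => -(y e.1 + t * g e.1) + (y e.2 + t * g e.2)) 0 := by
        fun_prop
      filter_upwards [nhdsWithin_le_nhds (hc.eventually_lt_const (by simpa using ht))] with t h
      exact h.le
  filter_upwards [(eventually_all_finite hE).2 key] with t ht
  exact ⟨by simp [hy.1, hg₀], ht⟩

/-- Extreme points with the same tight arcs coincide. -/
theorem eq_of_tight_iff_of_mem_extremePoints (hE : E.Finite) {x y : V → ℝ}
    (hx : x ∈ (dualPoly E v₀ c).extremePoints ℝ) (hy : y ∈ dualPoly E v₀ c)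
    (h : ∀ e ∈ E, -x e.1 + x e.2 = c e → -y e.1 + y e.2 = c e) : y = x := by
  have hx' := (mem_extremePoints_iff_left.1 hx).1
  have h₁ := eventually_add_smul_mem_dualPoly hE hx' (g := y - x) (by simp [hx'.1, hy.1])
    fun e he ht => by simp only [Pi.sub_apply]; linarith [h e he ht]
  have h₂ := eventually_add_smul_mem_dualPoly hE hx' (g := x - y) (by simp [hx'.1, hy.1])
    fun e he ht => by simp only [Pi.sub_apply]; linarith [h e he ht]
  obtain ⟨t, ⟨ht₁, ht₂⟩, h_pos⟩ := ((h₁.and h₂).and self_mem_nhdsWithin).exists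
  have h_eq := (mem_extremePoints_iff_left.1 hx).2 _ ht₁ _ ht₂
    ⟨1 / 2, 1 / 2, by norm_num, by norm_num, by norm_num, by ext; simp; ring⟩
  have h_zero : t • (y - x) = 0 := by simpa using h_eq
  exact sub_eq_zero.1 ((smul_eq_zero.1 h_zero).resolve_left (ne_of_gt h_pos))

theorem finite_extremePoints_dualPoly (hE : E.Finite) :
    ((dualPoly E v₀ c).extremePoints ℝ).Finite := by
  refine Set.Finite.of_finite_image (f := fun x => {e ∈ E | -x e.1 + x e.2 = c e})
    (hE.finite_subsets.subset ?_) ?_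
  · rintro _ ⟨x, -, rfl⟩
    exact Set.sep_subset _ _
  · intro x hx y hy hxy
    refine eq_of_tight_iff_of_mem_extremePoints hE hy (mem_extremePoints_iff_left.1 hx).1 ?_
    intro e he ht
    have : e ∈ {e ∈ E | -x e.1 + x e.2 = c e} := by
      rw [show {e ∈ E | -x e.1 + x e.2 = c e} = _ from hxy]
      exact ⟨he, ht⟩
    exact this.2

theorem circuitDist_le_circuitDiam (hE : E.Finite) {x y : V → ℝ}
    (hx : x ∈ (dualPoly E v₀ c).extremePoints ℝ) (hy : y ∈ (dualPoly E v₀ c).extremePoints ℝ) :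
    circuitDist E (dualPoly E v₀ c) x y ≤ circuitDiam E (dualPoly E v₀ c) := by
  have hfin := finite_extremePoints_dualPoly (v₀ := v₀) (c := c) hE
  refine le_csSup (((hfin.prod hfin).image fun p =>
    circuitDist E (dualPoly E v₀ c) p.1 p.2).subset ?_).bddAbove ⟨x, hx, y, hy, rfl⟩
  rintro _ ⟨u, hu, v, hv, rfl⟩
  exact ⟨(u, v), ⟨hu, hv⟩, rfl⟩

/-- A maximal step ends at a point where some arc that increases along the step is tight. -/
theorem exists_tight_of_maximal_step (hE : E.Finite) {x g : V → ℝ} {α : ℝ}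
    (hy : x + α • g ∈ dualPoly E v₀ c) (hg₀ : g v₀ = 0)
    (hmax : ∀ β : ℝ, α < β → x + β • g ∉ dualPoly E v₀ c) :
    ∃ e ∈ E, -(x + α • g) e.1 + (x + α • g) e.2 = c e ∧ 0 < -g e.1 + g e.2 := by
  by_contra! hcon
  obtain ⟨t, ht, h_pos⟩ :=
    ((eventually_add_smul_mem_dualPoly hE hy hg₀ hcon).and self_mem_nhdsWithin).exists
  refine hmax (α + t) (lt_add_of_pos_right α h_pos) ?_
  rwa [add_smul, ← add_assoc]

end TightArcs

/-- The edges of `G₄` as a finite set. -/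
def arcs : Finset (Fin 4 × Fin 4) :=
  {(3, 0), (2, 0), (3, 1), (0, 3), (0, 2), (1, 3), (0, 1), (1, 2), (2, 3)}

/-- The costs of `G₄` multiplied by `9`. -/
def scaledCost (e : Fin 4 × Fin 4) : ℤ :=
  if e = (3, 0) then 0 else if e = (2, 0) then 0 else if e = (3, 1) then 0
  else if e = (0, 3) then 18 else if e = (0, 2) then 12 else if e = (1, 3) then 12
  else if e = (0, 1) then 9 else if e = (1, 2) then 9 else if e = (2, 3) then 10 else 0

/-- Integer points, in units of `1 / 9`, of the dual polyhedron of `G₄`. -/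
def ScaledFeasible (z : Fin 4 → ℤ) : Prop :=
  z 0 = 0 ∧ ∀ e ∈ arcs, -z e.1 + z e.2 ≤ scaledCost e

instance : DecidablePred ScaledFeasible := fun _ =>
  inferInstanceAs (Decidable (_ ∧ _))

/-- The point of `ℝ⁴` with coordinates given in units of `1 / 9`. -/
noncomputable def unscale (z : Fin 4 → ℤ) : Fin 4 → ℝ := fun i => z i / 9

/-- The vector with value `s` on `S` and `0` elsewhere. -/
def signedIndicator (S : Finset (Fin 4)) (s : ℤ) : Fin 4 → ℤ := fun i => if i ∈ S then s else 0

/-- The slack of the arc `e` at the integer point `z`. -/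
def scaledSlack (z : Fin 4 → ℤ) (e : Fin 4 × Fin 4) : ℤ := scaledCost e - (-z e.1 + z e.2)

/-- The integer point reached from `z` by moving along `signedIndicator S s` until `e` is tight. -/
def scaledMove (z : Fin 4 → ℤ) (p : (Fin 4 × Fin 4) × Finset (Fin 4) × ℤ) : Fin 4 → ℤ :=
  fun i => z i + scaledSlack z p.1 * signedIndicator p.2.1 p.2.2 i

/-- `p = (e, S, s)` describes a maximal step from `z` along `signedIndicator S s` that is blocked
by the arc `e`. -/
def IsScaledStep (z : Fin 4 → ℤ) (p : (Fin 4 × Fin 4) × Finset (Fin 4) × ℤ) : Prop :=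
  -signedIndicator p.2.1 p.2.2 p.1.1 + signedIndicator p.2.1 p.2.2 p.1.2 = 1 ∧
    0 < scaledSlack z p.1 ∧ ScaledFeasible (scaledMove z p)

instance (z : Fin 4 → ℤ) : DecidablePred (IsScaledStep z) := fun _ =>
  inferInstanceAs (Decidable (_ ∧ _))

/-- The endpoints of the maximal circuit steps from `z`. -/
def successors (z : Fin 4 → ℤ) : Finset (Fin 4 → ℤ) :=
  ((arcs ×ˢ (Finset.univ : Finset (Finset (Fin 4))) ×ˢ ({1, -1} : Finset ℤ)).filter
    (IsScaledStep z)).image (scaledMove z)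

/-- The integer points reached from the origin by circuit walks of length `k`. -/
def reachable : ℕ → Finset (Fin 4 → ℤ)
  | 0 => {0}
  | k + 1 => (reachable k).biUnion successors

theorem exampleE_eq : exampleE = ↑arcs := by
  simp [exampleE, arcs]

theorem exampleC_eq (e : Fin 4 × Fin 4) : exampleC e = scaledCost e / 9 := by
  unfold exampleC scaledCost
  split_ifs <;> norm_num

theorem finite_exampleE : exampleE.Finite := exampleE_eq ▸ arcs.finite_toSet

theorem unscale_mem {z : Fin 4 → ℤ} :
    unscale z ∈ dualPoly exampleE 0 exampleC ↔ ScaledFeasible z := by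
  have h (e : Fin 4 × Fin 4) :
      -((z e.1 : ℝ) / 9) + z e.2 / 9 ≤ scaledCost e / 9 ↔ -z e.1 + z e.2 ≤ scaledCost e := by
    rw [← neg_div, ← add_div, div_le_div_iff_of_pos_right (by norm_num)]
    norm_cast
  simp only [dualPoly, ScaledFeasible, unscale, exampleE_eq, exampleC_eq, Set.mem_ofPred_eq,
    Finset.mem_coe, h]
  simp

theorem uAdj_exampleE {a b : Fin 4} (h : a ≠ b) : UAdj exampleE a b := by
  simp only [UAdj, exampleE_eq, Finset.mem_coe]
  revert a b
  decide

theorem setConnected_exampleE (S : Set (Fin 4)) : SetConnected exampleE S := by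
  intro a ha b hb
  rcases eq_or_ne a b with rfl | h
  · exact .refl
  · exact .single ⟨ha, hb, uAdj_exampleE h⟩

/-- The circuits of `G₄` are the signed indicators of nonempty proper node sets. -/
theorem isCircuit_exampleE {g : Fin 4 → ℝ} :
    IsCircuit exampleE g ↔ ∃ S : Finset (Fin 4), ∃ s ∈ ({1, -1} : Finset ℤ),
      S.Nonempty ∧ Sᶜ.Nonempty ∧ g = fun i => (signedIndicator S s i : ℝ) := by
  classical
  have h_pos (S : Finset (Fin 4)) :
      (S : Set (Fin 4)).indicator 1 = fun i => (signedIndicator S 1 i : ℝ) := by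
    ext i
    by_cases hi : i ∈ S <;> simp [signedIndicator, hi]
  have h_neg (S : Finset (Fin 4)) :
      -(S : Set (Fin 4)).indicator (1 : Fin 4 → ℝ) = fun i => (signedIndicator S (-1) i : ℝ) := by
    ext i
    by_cases hi : i ∈ S <;> simp [signedIndicator, hi]
  constructor
  · rintro ⟨S, hS, hS', -, -, hg⟩
    obtain ⟨S, rfl⟩ : ∃ T : Finset (Fin 4), (T : Set (Fin 4)) = S := ⟨S.toFinset, by simp⟩
    rw [h_neg, h_pos] at hg
    have hS'' : Sᶜ.Nonempty := by exact_mod_cast hS'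
    rcases hg with hg | hg
    · exact ⟨S, 1, by simp, hS, hS'', hg⟩
    · exact ⟨S, -1, by simp, hS, hS'', hg⟩
  · rintro ⟨S, s, hs, hS, hS', hg⟩
    refine ⟨S, hS, by exact_mod_cast hS', setConnected_exampleE _, setConnected_exampleE _, ?_⟩
    rw [h_neg, h_pos]
    simp only [Finset.mem_insert, Finset.mem_singleton] at hs
    rcases hs with rfl | rfl
    · exact .inl hg
    · exact .inr hg

theorem unscale_scaledMove (z : Fin 4 → ℤ) (p : (Fin 4 × Fin 4) × Finset (Fin 4) × ℤ) :
    unscale (scaledMove z p) = unscale z +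
      ((scaledSlack z p.1 : ℝ) / 9) • fun i => (signedIndicator p.2.1 p.2.2 i : ℝ) := by
  ext i
  simp [unscale, scaledMove]
  ring

/-- A maximal circuit step from a point of `ℤ⁴ / 9` is one of the listed integer steps. -/
theorem exists_successor {z : Fin 4 → ℤ} {y g : Fin 4 → ℝ} {α : ℝ}
    (hz : unscale z ∈ dualPoly exampleE 0 exampleC) (hy : y ∈ dualPoly exampleE 0 exampleC)
    (hg : IsCircuit exampleE g) (hα : 0 < α) (hstep : y = unscale z + α • g)
    (hmax : ∀ β : ℝ, α < β → unscale z + β • g ∉ dualPoly exampleE 0 exampleC) :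
    ∃ z' ∈ successors z, y = unscale z' := by
  subst hstep
  have hg₀ : g 0 = 0 := by
    have h := hy.1
    simp only [Pi.add_apply, Pi.smul_apply, smul_eq_mul, hz.1, zero_add] at h
    exact (mul_eq_zero.1 h).resolve_left hα.ne'
  obtain ⟨e, he, ht, hlt⟩ := exists_tight_of_maximal_step finite_exampleE hy hg₀ hmax
  obtain ⟨S, s, hs, -, -, rfl⟩ := isCircuit_exampleE.1 hg
  have hd : -signedIndicator S s e.1 + signedIndicator S s e.2 = 1 := by
    have hlt' : 0 < -signedIndicator S s e.1 + signedIndicator S s e.2 := by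
      beta_reduce at hlt
      exact_mod_cast hlt
    simp only [Finset.mem_insert, Finset.mem_singleton] at hs
    unfold signedIndicator at hlt' ⊢
    split_ifs at hlt' ⊢ <;> omega
  have hd' : -(signedIndicator S s e.1 : ℝ) + signedIndicator S s e.2 = 1 := by exact_mod_cast hd
  have hα' : α = (scaledSlack z e : ℝ) / 9 := by
    simp only [Pi.add_apply, Pi.smul_apply, smul_eq_mul, unscale, exampleC_eq] at ht
    simp only [scaledSlack]
    push_cast
    linear_combination ht - α * hd'
  have hmove := unscale_scaledMove z (e, S, s)
  rw [← hα'] at hmove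
  refine ⟨scaledMove z (e, S, s), ?_, hmove.symm⟩
  refine Finset.mem_image_of_mem _ (Finset.mem_filter.2 ⟨?_, hd, ?_, ?_⟩)
  · rw [exampleE_eq] at he
    simpa using ⟨he, by simpa using hs⟩
  · rw [hα'] at hα
    have : (0 : ℝ) < scaledSlack z e := by linarith
    exact_mod_cast this
  · exact unscale_mem.1 (hmove ▸ hy)

/-- The listed integer steps are maximal circuit steps. -/
theorem exists_circuit_of_mem_successors {z z' : Fin 4 → ℤ} (h : z' ∈ successors z) :
    ∃ (g : Fin 4 → ℝ) (α : ℝ), IsCircuit exampleE g ∧ 0 < α ∧ unscale z' = unscale z + α • g ∧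
      ∀ β : ℝ, α < β → unscale z + β • g ∉ dualPoly exampleE 0 exampleC := by
  obtain ⟨⟨e, S, s⟩, hp, rfl⟩ := Finset.mem_image.1 h
  obtain ⟨hp, hd, hk, -⟩ := Finset.mem_filter.1 hp
  simp only [Finset.mem_product, Finset.mem_univ, true_and] at hp
  refine ⟨_, _, isCircuit_exampleE.2 ⟨S, s, hp.2, ?_, ?_, rfl⟩, ?_, unscale_scaledMove _ _, ?_⟩
  · by_contra! hS
    simp [hS, signedIndicator] at hd
  · by_contra! hS
    rw [Finset.compl_eq_empty_iff] at hS
    simp [hS, signedIndicator] at hd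
  · have : (0 : ℝ) < scaledSlack z e := by exact_mod_cast hk
    positivity
  · intro β hβ hmem
    have hle := hmem.2 e (by rw [exampleE_eq]; exact hp.1)
    have hd' : -(signedIndicator S s e.1 : ℝ) + signedIndicator S s e.2 = 1 := by
      exact_mod_cast hd
    simp only [Pi.add_apply, Pi.smul_apply, smul_eq_mul, unscale, exampleC_eq] at hle
    simp only [scaledSlack] at hβ
    push_cast at hβ
    linarith [congrArg (β * ·) hd']

theorem exists_reachable {n : ℕ} {w : Fin (n + 1) → Fin 4 → ℝ}
    (hw : IsCircuitWalk exampleE (dualPoly exampleE 0 exampleC) w) (h₀ : w 0 = unscale 0)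
    (i : Fin (n + 1)) : ∃ z ∈ reachable i, w i = unscale z := by
  induction i using Fin.induction with
  | zero => exact ⟨0, by simp [reachable], h₀⟩
  | succ i ih =>
    obtain ⟨z, hz, hwz⟩ := ih
    obtain ⟨g, α, hg, hα, hstep, hmax⟩ := hw.2 i
    rw [hwz] at hstep hmax
    obtain ⟨z', hz', hwz'⟩ :=
      exists_successor (hwz ▸ hw.1 i.castSucc) (hw.1 i.succ) hg hα hstep hmax
    exact ⟨z', Finset.mem_biUnion.2 ⟨z, hz, hz'⟩, hwz'⟩

theorem unscale_injective : Function.Injective unscale := by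
  intro z z' h
  ext i
  have := congrFun h i
  simp only [unscale] at this
  exact_mod_cast (div_left_inj' (by norm_num : (9 : ℝ) ≠ 0)).1 this

theorem target_notMem_reachable : ∀ k < 4, ![0, 6, 12, 18] ∉ reachable k := by
  decide +kernel

theorem unscale_zero : unscale 0 = fun _ => (0 : ℝ) := by
  ext i
  simp [unscale]

theorem unscale_target : unscale ![0, 6, 12, 18] = ![0, 2 / 3, 4 / 3, 2] := by
  ext i
  fin_cases i <;> norm_num [unscale]

theorem four_le_of_isCircuitWalk {n : ℕ} {w : Fin (n + 1) → Fin 4 → ℝ}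
    (hw : IsCircuitWalk exampleE (dualPoly exampleE 0 exampleC) w) (h₀ : w 0 = unscale 0)
    (h₁ : w (Fin.last n) = unscale ![0, 6, 12, 18]) : 4 ≤ n := by
  by_contra! hn
  obtain ⟨z, hz, hwz⟩ := exists_reachable hw h₀ (Fin.last n)
  rw [← unscale_injective (h₁.symm.trans hwz)] at hz
  exact target_notMem_reachable n hn hz

theorem exists_isCircuitWalk : ∃ w : Fin (4 + 1) → Fin 4 → ℝ,
    IsCircuitWalk exampleE (dualPoly exampleE 0 exampleC) w ∧ w 0 = unscale 0 ∧
      w (Fin.last 4) = unscale ![0, 6, 12, 18] := by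
  let p : Fin 5 → Fin 4 → ℤ :=
    ![0, ![0, 0, 0, 10], ![0, 0, 2, 12], ![0, 6, 8, 18], ![0, 6, 12, 18]]
  have h_feas : ∀ i, ScaledFeasible (p i) := by decide +kernel
  have h_step : ∀ i : Fin 4, p i.succ ∈ successors (p i.castSucc) := by decide +kernel
  exact ⟨fun i => unscale (p i), ⟨fun i => unscale_mem.2 (h_feas i),
    fun i => exists_circuit_of_mem_successors (h_step i)⟩, rfl, rfl⟩

theorem zero_mem_extremePoints :
    unscale 0 ∈ (dualPoly exampleE 0 exampleC).extremePoints ℝ := by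
  refine mem_extremePoints_dualPoly_of_tight (unscale_mem.2 (by decide)) fun y hy h => ?_
  have h₃ := h (3, 0) (by simp [exampleE]) (by simp [unscale, exampleC])
  have h₂ := h (2, 0) (by simp [exampleE]) (by simp [unscale, exampleC])
  have h₁ := h (3, 1) (by simp [exampleE]) (by simp [unscale, exampleC])
  have h₀ := hy.1
  simp [exampleC] at h₁ h₂ h₃
  ext i
  fin_cases i <;> simp [unscale] <;> linarith

theorem target_mem_extremePoints :
    unscale ![0, 6, 12, 18] ∈ (dualPoly exampleE 0 exampleC).extremePoints ℝ := by
  refine mem_extremePoints_dualPoly_of_tight (unscale_mem.2 (by decide)) fun y hy h => ?_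
  have h₃ := h (0, 3) (by simp [exampleE]) (by simp [unscale_target, exampleC])
  have h₂ := h (0, 2) (by simp [exampleE]) (by simp [unscale_target, exampleC])
  have h₁ := h (1, 3) (by simp [exampleE]) 
    (by simp [unscale_target, exampleC]; norm_num)
  have h₀ := hy.1
  simp [exampleC] at h₁ h₂ h₃
  ext i
  fin_cases i <;> simp [unscale] <;> linarith

/-- **Example 1.**
In the dual network flow polyhedron of the graph `G₄`, the points `u¹ = (0,0,0,0)` and
`u² = (0, 2/3, 4/3, 2)` are extreme points, every circuit walk from `u¹` to `u²` has length
at least `4`, and in particular the circuit diameter is at least `4 = |V|`. -/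
theorem example_circuit_distance_four :
    (fun _ : Fin 4 => (0 : ℝ)) ∈ (dualPoly exampleE 0 exampleC).extremePoints ℝ ∧
    (![0, 2 / 3, 4 / 3, 2] : Fin 4 → ℝ) ∈ (dualPoly exampleE 0 exampleC).extremePoints ℝ ∧
    (∀ (n : ℕ) (w : Fin (n + 1) → Fin 4 → ℝ),
      IsCircuitWalk exampleE (dualPoly exampleE 0 exampleC) w →
        w 0 = (fun _ : Fin 4 => (0 : ℝ)) → w (Fin.last n) = ![0, 2 / 3, 4 / 3, 2] → 4 ≤ n) ∧
    4 ≤ circuitDiam exampleE (dualPoly exampleE 0 exampleC) := by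
  rw [← unscale_zero, ← unscale_target]
  have h_zero := zero_mem_extremePoints
  have h_target := target_mem_extremePoints
  refine ⟨h_zero, h_target, fun n w hw h₀ h₁ => four_le_of_isCircuitWalk hw h₀ h₁, ?_⟩
  refine le_trans ?_ (circuitDist_le_circuitDiam finite_exampleE h_zero h_target)
  refine le_csInf ⟨4, exists_isCircuitWalk⟩ ?_
  rintro n ⟨w, hw, h₀, h₁⟩
  exact four_le_of_isCircuitWalk hw h₀ h₁
end

section
/- For every integer n ≥ 4 there exist a directed graph G = (V, E) on |V| = n nodes, connected in its underlying undirected graph, with a distinguished node v₀, and a cost vector c : E → ℝ, such that the circuit diameter of the dual network flow polyhedron P(G,c) is at least (4/3)·n − 4; that is, there exist two extreme points of P(G,c) such that every circuit walk from one to the other has length at least (4/3)·n − 4. -/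
open scoped BigOperators

namespace BlockGadget

/-- The polyhedron of one block: the potentials of its three nodes, the hub having potential `0`. -/
structure Feasible (x y z : ℝ) : Prop where
  hub_fst : x ≤ 0
  hub_thd : z ≤ 3
  fst_hub : -3 ≤ x
  snd_hub : -4 ≤ y
  thd_hub : 0 ≤ z
  fst_snd : y ≤ x
  fst_thd : z ≤ x + 4
  snd_fst : x ≤ y + 3
  snd_thd : z ≤ y + 6

/-- The points of a block reached from the origin by at most one circuit step. -/
def NearOne (x y z : ℝ) : Prop :=
  (x = 0 ∧ y = 0 ∧ z = 0) ∨ (x = -3 ∧ y = -3 ∧ z = 0) ∨ (x = 0 ∧ y = -3 ∧ z = 0) ∨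
    (x = 0 ∧ y = 0 ∧ z = 3)

/-- The points of a block reached from the origin by at most two circuit steps. -/
def NearTwo (x y z : ℝ) : Prop :=
  NearOne x y z ∨ (x = -3 ∧ y = -4 ∧ z = 0) ∨ (x = -3 ∧ y = -3 ∧ z = 1) ∨
    (x = -1 ∧ y = -4 ∧ z = 0) ∨ (x = -1 ∧ y = -1 ∧ z = 3) ∨ (x = 0 ∧ y = -3 ∧ z = 3)

/-- A maximal step inside a block, along a signed indicator vector of a set of its nodes. -/
structure BlockStep (x y z x' y' z' : ℝ) : Prop where
  feasible : Feasible x y z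
  feasible' : Feasible x' y' z'
  exists_maximal : ∃ a b c σ α : ℝ, (a = 0 ∨ a = 1) ∧ (b = 0 ∨ b = 1) ∧ (c = 0 ∨ c = 1) ∧
    (σ = 1 ∨ σ = -1) ∧ 0 < α ∧ x' = x + α * (σ * a) ∧ y' = y + α * (σ * b) ∧
    z' = z + α * (σ * c) ∧
    ∀ β, α < β → ¬ Feasible (x + β * (σ * a)) (y + β * (σ * b)) (z + β * (σ * c))

theorem BlockStep.nearOne {x' y' z' : ℝ} (h : BlockStep 0 0 0 x' y' z') : NearOne x' y' z' := by
  obtain ⟨-, ⟨h1, h2, h3, h4, h5, h6, h7, h8, h9⟩, a, b, c, σ, α, ha, hb, hc, hσ, hα,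
    rfl, rfl, rfl, hmax⟩ := h
  unfold NearOne
  rcases hσ with rfl | rfl <;> rcases ha with rfl | rfl <;> rcases hb with rfl | rfl <;>
    rcases hc with rfl | rfl <;>
  first
  | (exfalso; linarith)
  | (refine absurd ?_ (hmax (α + 1) (by linarith)); constructor <;> linarith)
  | (have hle : α ≤ 3 := by linarith
     rcases hle.lt_or_eq with hlt | rfl
     · refine absurd ?_ (hmax 3 hlt)
       constructor <;> norm_num
     · norm_num)

theorem BlockStep.nearTwo {x y z x' y' z' : ℝ} (h : BlockStep x y z x' y' z')
    (hxyz : NearOne x y z) : NearTwo x' y' z' := by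
  rcases hxyz with ⟨rfl, rfl, rfl⟩ | hxyz
  · exact Or.inl h.nearOne
  obtain ⟨-, ⟨h1, h2, h3, h4, h5, h6, h7, h8, h9⟩, a, b, c, σ, α, ha, hb, hc, hσ, hα,
    rfl, rfl, rfl, hmax⟩ := h
  unfold NearTwo NearOne
  rcases hxyz with ⟨rfl, rfl, rfl⟩ | ⟨rfl, rfl, rfl⟩ | ⟨rfl, rfl, rfl⟩ <;>
  rcases hσ with rfl | rfl <;> rcases ha with rfl | rfl <;> rcases hb with rfl | rfl <;>
    rcases hc with rfl | rfl <;>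
  first
  | (exfalso; linarith)
  | (refine absurd ?_ (hmax (α + 1) (by linarith)); constructor <;> linarith)
  | (have hle : α ≤ 1 := by linarith
     rcases hle.lt_or_eq with hlt | rfl
     · refine absurd ?_ (hmax 1 hlt)
       constructor <;> norm_num
     · norm_num)
  | (have hle : α ≤ 3 := by linarith
     rcases hle.lt_or_eq with hlt | rfl
     · refine absurd ?_ (hmax 3 hlt)
       constructor <;> norm_num
     · norm_num)

theorem BlockStep.ne_target {x y z x' y' z' : ℝ} (h : BlockStep x y z x' y' z')
    (hxyz : NearTwo x y z) : ¬ (x' = -2 ∧ y' = -4 ∧ z' = 2) := by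
  obtain ⟨-, -, a, b, c, σ, α, ha, hb, hc, hσ, hα, rfl, rfl, rfl, -⟩ := h
  rintro ⟨e1, e2, e3⟩
  rcases hxyz with (⟨rfl, rfl, rfl⟩ | ⟨rfl, rfl, rfl⟩ | ⟨rfl, rfl, rfl⟩ | ⟨rfl, rfl, rfl⟩) |
    ⟨rfl, rfl, rfl⟩ | ⟨rfl, rfl, rfl⟩ | ⟨rfl, rfl, rfl⟩ | ⟨rfl, rfl, rfl⟩ | ⟨rfl, rfl, rfl⟩ <;>
  rcases hσ with rfl | rfl <;> rcases ha with rfl | rfl <;> rcases hb with rfl | rfl <;>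
    rcases hc with rfl | rfl <;> linarith

open Classical in
/-- A lower bound for the number of steps from the origin of a block, capped at the target. -/
noncomputable def level (x y z : ℝ) : ℕ :=
  if x = 0 ∧ y = 0 ∧ z = 0 then 0 else if NearOne x y z then 1 else if NearTwo x y z then 2
  else if x = -2 ∧ y = -4 ∧ z = 2 then 4 else 3

theorem level_origin : level 0 0 0 = 0 := by simp [level]

theorem level_target : level (-2) (-4) 2 = 4 := by
  norm_num [level, NearOne, NearTwo]

theorem BlockStep.level_le {x y z x' y' z' : ℝ} (h : BlockStep x y z x' y' z') :
    level x' y' z' ≤ level x y z + 1 := by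
  have h₁ : x = 0 ∧ y = 0 ∧ z = 0 → NearOne x' y' z' := by
    rintro ⟨rfl, rfl, rfl⟩
    exact h.nearOne
  have h₂ := h.nearTwo
  have h₃ := h.ne_target
  unfold level
  split_ifs <;> first | omega | tauto

end BlockGadget

theorem mem_extremePoints_dualPoly {V : Type*} {E : Set (V × V)} {v₀ : V} {c : V × V → ℝ}
    {u : V → ℝ} (hu : u ∈ dualPoly E v₀ c)
    (htight : ∀ p ∈ dualPoly E v₀ c,
      (∀ e ∈ E, -u e.1 + u e.2 = c e → -p e.1 + p e.2 = c e) → p = u) :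
    u ∈ (dualPoly E v₀ c).extremePoints ℝ := by
  refine mem_extremePoints_iff_left.2 ⟨hu, fun p hp q hq hpq => htight p hp fun e he hue => ?_⟩
  obtain ⟨s, t, hs, ht, hst, rfl⟩ := hpq
  have hpe := hp.2 e he
  have hqe := hq.2 e he
  simp only [Pi.add_apply, Pi.smul_apply, smul_eq_mul] at hue
  refine le_antisymm hpe (not_lt.1 fun hlt => ?_)
  have h₁ := mul_lt_mul_of_pos_left hlt hs
  have h₂ := mul_le_mul_of_nonneg_left hqe ht.le
  have h₃ : s * c e + t * c e = c e := by rw [← add_mul, hst, one_mul]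
  linarith

namespace BlockGadget

variable {n k : ℕ}

/-- The role of a node: `0` for the hub, and `1`, `2`, `3` within each block. -/
def role (i : ℕ) : ℕ := if i = 0 then 0 else (i - 1) % 3 + 1

/-- The costs inside a block, in terms of the roles of the two nodes. -/
def blockCost : ℕ → ℕ → ℝ
  | 0, 3 => 3
  | 1, 0 => 3
  | 1, 3 => 4
  | 2, 0 => 4
  | 2, 1 => 3
  | 2, 3 => 6
  | _, _ => 0

/-- The potentials of the target vertex, in terms of roles. -/
def blockTarget : ℕ → ℝ
  | 1 => -2
  | 2 => -4
  | 3 => 2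
  | _ => 0

/-- Complete graphs on the blocks `{3j+1, 3j+2, 3j+3}`, all joined at the hub `0`. -/
def edges (n : ℕ) : Set (Fin n × Fin n) :=
  {e | e.1 ≠ e.2 ∧
    ((e.1 : ℕ) = 0 ∨ (e.2 : ℕ) = 0 ∨ ((e.1 : ℕ) - 1) / 3 = ((e.2 : ℕ) - 1) / 3)}

/-- The costs: `blockCost` on the first `k` blocks and the hub, and `0` elsewhere. -/
def cost (n k : ℕ) (e : Fin n × Fin n) : ℝ :=
  if (e.1 : ℕ) ≤ 3 * k ∧ (e.2 : ℕ) ≤ 3 * k then blockCost (role e.1) (role e.2) else 0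

/-- The target vertex. -/
def target (n k : ℕ) (i : Fin n) : ℝ := if (i : ℕ) ≤ 3 * k then blockTarget (role i) else 0

/-- The polyhedron of the gadget. -/
abbrev poly (n k : ℕ) [NeZero n] : Set (Fin n → ℝ) := dualPoly (edges n) 0 (cost n k)

/-- The nodes of the `j`-th block. -/
def node (hn : 3 * k < n) (j : Fin k) (s : Fin 3) : Fin n := ⟨3 * j + s + 1, by omega⟩

theorem val_node (hn : 3 * k < n) (j : Fin k) (s : Fin 3) :
    (node hn j s : ℕ) = 3 * j + s + 1 := rfl

theorem node_inj (hn : 3 * k < n) {i j : Fin k} {s t : Fin 3} (h : node hn i s = node hn j t) :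
    i = j ∧ s = t := by
  have := congrArg Fin.val h
  simp only [val_node] at this
  omega

theorem val_node_le (hn : 3 * k < n) (j : Fin k) (s : Fin 3) : (node hn j s : ℕ) ≤ 3 * k := by
  rw [val_node]
  omega

theorem role_node (hn : 3 * k < n) (j : Fin k) (s : Fin 3) : role (node hn j s) = s + 1 := by
  rw [role, val_node, if_neg (by omega)]
  omega

theorem role_zero : role 0 = 0 := rfl

theorem node_mem_edges (hn : 3 * k < n) (j : Fin k) {s t : Fin 3} (hst : s ≠ t) :
    (node hn j s, node hn j t) ∈ edges n :=
  ⟨fun h => hst (node_inj hn h).2, by simp only [val_node]; omega⟩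

theorem cost_node_node (hn : 3 * k < n) (i j : Fin k) (s t : Fin 3) :
    cost n k (node hn i s, node hn j t) = blockCost (s + 1) (t + 1) := by
  simp [cost, val_node_le, role_node]

theorem target_node (hn : 3 * k < n) (j : Fin k) (s : Fin 3) :
    target n k (node hn j s) = blockTarget (s + 1) := by
  simp [target, val_node_le, role_node]

/-- The total level of a point, summed over the blocks. -/
noncomputable def totalLevel (hn : 3 * k < n) (u : Fin n → ℝ) : ℕ :=
  ∑ j, level (u (node hn j 0)) (u (node hn j 1)) (u (node hn j 2))

theorem totalLevel_zero (hn : 3 * k < n) : totalLevel hn 0 = 0 := by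
  simp [totalLevel, level_origin]

theorem totalLevel_target (hn : 3 * k < n) : totalLevel hn (target n k) = 4 * k := by
  simp [totalLevel, target_node, blockTarget, level_target, mul_comm]

variable [NeZero n]

theorem node_ne_zero (hn : 3 * k < n) (j : Fin k) (s : Fin 3) : node hn j s ≠ 0 := fun h => by
  have := congrArg Fin.val h
  simp [val_node] at this

theorem eq_zero_or_node_or_lt (hn : 3 * k < n) (i : Fin n) :
    i = 0 ∨ (∃ j s, i = node hn j s) ∨ 3 * k < (i : ℕ) := by
  rcases Nat.eq_zero_or_pos (i : ℕ) with h0 | h0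
  · exact Or.inl (Fin.ext (by simpa using h0))
  · rcases le_or_gt (i : ℕ) (3 * k) with h | h
    · refine Or.inr (Or.inl ⟨⟨((i : ℕ) - 1) / 3, by omega⟩, ⟨((i : ℕ) - 1) % 3, by omega⟩, ?_⟩)
      apply Fin.ext
      simp only [val_node]
      omega
    · exact Or.inr (Or.inr h)

theorem hub_mem_edges {i : Fin n} (hi : i ≠ 0) : (0, i) ∈ edges n := ⟨hi.symm, by simp⟩

theorem mem_edges_hub {i : Fin n} (hi : i ≠ 0) : (i, 0) ∈ edges n := ⟨hi, by simp⟩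

theorem cost_hub_node (hn : 3 * k < n) (j : Fin k) (s : Fin 3) :
    cost n k (0, node hn j s) = blockCost 0 (s + 1) := by
  simp [cost, val_node_le, role_node, role_zero]

theorem cost_node_hub (hn : 3 * k < n) (j : Fin k) (s : Fin 3) :
    cost n k (node hn j s, 0) = blockCost (s + 1) 0 := by
  simp [cost, val_node_le, role_node, role_zero]

theorem uConnected_edges : UConnected (edges n) := by
  have h0 (a : Fin n) : Relation.ReflTransGen (UAdj (edges n)) a 0 ∧
      Relation.ReflTransGen (UAdj (edges n)) 0 a := by
    rcases eq_or_ne a 0 with rfl | ha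
    · exact ⟨.refl, .refl⟩
    · exact ⟨.single (Or.inl (mem_edges_hub ha)), .single (Or.inl (hub_mem_edges ha))⟩
  exact fun a b => (h0 a).1.trans (h0 b).2

theorem eq_zero_of_mem_poly {u : Fin n → ℝ} (hu : u ∈ poly n k) {i : Fin n}
    (hi : 3 * k < (i : ℕ)) : u i = 0 := by
  have hi0 : i ≠ 0 := by
    rintro rfl
    simp at hi
  have h₁ := hu.2 _ (hub_mem_edges hi0)
  have h₂ := hu.2 _ (mem_edges_hub hi0)
  simp only [cost, hi.not_ge, and_false, false_and, if_false, hu.1] at h₁ h₂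
  linarith

theorem feasible_of_mem_poly (hn : 3 * k < n) {u : Fin n → ℝ} (hu : u ∈ poly n k) (j : Fin k) :
    Feasible (u (node hn j 0)) (u (node hn j 1)) (u (node hn j 2)) := by
  have h₁ (s : Fin 3) : -u 0 + u (node hn j s) ≤ blockCost 0 (s + 1) :=
    cost_hub_node hn j s ▸ hu.2 _ (hub_mem_edges (node_ne_zero hn j s))
  have h₂ (s : Fin 3) : -u (node hn j s) + u 0 ≤ blockCost (s + 1) 0 :=
    cost_node_hub hn j s ▸ hu.2 _ (mem_edges_hub (node_ne_zero hn j s))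
  have h₃ {s t : Fin 3} (hst : s ≠ t) :
      -u (node hn j s) + u (node hn j t) ≤ blockCost (s + 1) (t + 1) :=
    cost_node_node hn j j s t ▸ hu.2 _ (node_mem_edges hn j hst)
  have h01 := h₃ (s := 0) (t := 1) (by decide)
  have h02 := h₃ (s := 0) (t := 2) (by decide)
  have h10 := h₃ (s := 1) (t := 0) (by decide)
  have h12 := h₃ (s := 1) (t := 2) (by decide)
  have hf0 := h₁ 0
  have hf2 := h₁ 2
  have hb0 := h₂ 0
  have hb1 := h₂ 1
  have hb2 := h₂ 2
  simp [blockCost, hu.1] at h01 h02 h10 h12 hf0 hf2 hb0 hb1 hb2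
  constructor <;> linarith

theorem mem_poly_of_eq_off_block (hn : 3 * k < n) {u v : Fin n → ℝ} (hu : u ∈ poly n k)
    (j : Fin k) (hv : ∀ i, (∀ s, i ≠ node hn j s) → v i = u i)
    (hfeas : Feasible (v (node hn j 0)) (v (node hn j 1)) (v (node hn j 2))) :
    v ∈ poly n k := by
  have hv0 : v 0 = 0 := by
    rw [hv 0 fun s => (node_ne_zero hn j s).symm, hu.1]
  have hub_of_adj {a : Fin n} (ha : ∀ s, a ≠ node hn j s) {s : Fin 3}
      (h : (a : ℕ) = 0 ∨ ((a : ℕ) - 1) / 3 = ((node hn j s : ℕ) - 1) / 3) : a = 0 := by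
    rcases eq_zero_or_node_or_lt hn a with h0 | ⟨i, t, rfl⟩ | hlt
    · exact h0
    · rcases h with h | h
      · simp [val_node] at h
      · simp only [val_node] at h
        exact absurd (congrArg (node hn · t) (Fin.ext (by omega))) (ha t)
    · rcases h with h | h
      · omega
      · rw [val_node] at h
        omega
  obtain ⟨h1, h2, h3, h4, h5, h6, h7, h8, h9⟩ := hfeas
  refine ⟨hv0, ?_⟩
  rintro ⟨a, b⟩ ⟨hab, hadj⟩
  have hne (s : Fin 3) : (node hn j s : ℕ) ≠ 0 := by simp [val_node]
  by_cases ha : ∃ s, a = node hn j s <;> by_cases hb : ∃ t, b = node hn j t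
  · obtain ⟨s, rfl⟩ := ha
    obtain ⟨t, rfl⟩ := hb
    rw [cost_node_node]
    fin_cases s <;> fin_cases t <;> simp [blockCost] at hab ⊢ <;> linarith
  · obtain ⟨s, rfl⟩ := ha
    push Not at hb
    obtain rfl := hub_of_adj (s := s) hb (by
      rcases hadj with h | h | h
      exacts [absurd h (hne s), Or.inl h, Or.inr h.symm])
    rw [cost_node_hub]
    fin_cases s <;> simp [blockCost, hv0] <;> linarith
  · obtain ⟨t, rfl⟩ := hb
    push Not at ha
    obtain rfl := hub_of_adj (s := t) ha (by
      rcases hadj with h | h | h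
      exacts [Or.inl h, absurd h (hne t), Or.inr h])
    rw [cost_hub_node]
    fin_cases t <;> simp [blockCost, hv0] <;> linarith
  · push Not at ha hb
    have := hu.2 (a, b) ⟨hab, hadj⟩
    simpa only [hv a ha, hv b hb] using this

theorem exists_block_of_setConnected (hn : 3 * k < n) {S : Set (Fin n)} (hS : S.Nonempty)
    (hconn : SetConnected (edges n) S) (h0 : (0 : Fin n) ∉ S)
    (hpend : ∀ i ∈ S, (i : ℕ) ≤ 3 * k) : ∃ j, ∀ i ∈ S, ∃ s, i = node hn j s := by
  have hnode : ∀ i ∈ S, ∃ j s, i = node hn j s := fun i hi =>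
    ((eq_zero_or_node_or_lt hn i).resolve_left fun h => h0 (h ▸ hi)).resolve_right
      (hpend i hi).not_gt
  obtain ⟨a, ha⟩ := hS
  obtain ⟨j, s, rfl⟩ := hnode a ha
  refine ⟨j, fun i hi => ?_⟩
  induction hconn _ ha _ hi with
  | refl => exact ⟨s, rfl⟩
  | @tail b c _ hbc ih =>
    obtain ⟨hb, hc, hbc⟩ := hbc
    obtain ⟨t, rfl⟩ := ih hb
    obtain ⟨j', t', rfl⟩ := hnode c hc
    refine ⟨t', congrArg (node hn · t') (Fin.ext ?_)⟩
    rcases hbc with ⟨-, h⟩ | ⟨-, h⟩ <;> simp only [val_node] at h <;> omega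

theorem totalLevel_step_le (hn : 3 * k < n) {p q g : Fin n → ℝ} {α : ℝ} (hp : p ∈ poly n k)
    (hq : q ∈ poly n k) (hg : IsCircuit (edges n) g) (hα : 0 < α) (hpq : q = p + α • g)
    (hmax : ∀ β : ℝ, α < β → p + β • g ∉ poly n k) :
    totalLevel hn q ≤ totalLevel hn p + 1 := by
  classical
  obtain ⟨S, hS, -, hconn, -, hgS⟩ := hg
  obtain ⟨σ, hσ, hgσ⟩ : ∃ σ : ℝ, (σ = 1 ∨ σ = -1) ∧
      ∀ i, g i = σ * S.indicator (1 : Fin n → ℝ) i := by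
    rcases hgS with rfl | rfl
    · exact ⟨1, Or.inl rfl, fun i => (one_mul _).symm⟩
    · exact ⟨-1, Or.inr rfl, fun i => by simp⟩
  have hσ0 : σ ≠ 0 := by rcases hσ with rfl | rfl <;> norm_num
  have hqi (i : Fin n) : q i = p i + α * (σ * S.indicator (1 : Fin n → ℝ) i) := by
    simp [hpq, hgσ]
  have hfixed (i : Fin n) (h : q i = p i) : i ∉ S := fun hi => by
    have := hqi i
    simp [h, hi, hα.ne', hσ0] at this
  obtain ⟨j, hj⟩ := exists_block_of_setConnected hn hS hconn (hfixed 0 (by rw [hp.1, hq.1]))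
    fun i hi => not_lt.1 fun h =>
      hfixed i (by rw [eq_zero_of_mem_poly hp h, eq_zero_of_mem_poly hq h]) hi
  have hoff (i : Fin n) (hi : ∀ s, i ≠ node hn j s) : S.indicator (1 : Fin n → ℝ) i = 0 :=
    Set.indicator_of_notMem (fun h => (hj i h).elim hi) _
  have hind (i : Fin n) :
      S.indicator (1 : Fin n → ℝ) i = 0 ∨ S.indicator (1 : Fin n → ℝ) i = 1 := by
    by_cases h : i ∈ S <;> simp [h]
  have hstep : BlockStep (p (node hn j 0)) (p (node hn j 1)) (p (node hn j 2))
      (q (node hn j 0)) (q (node hn j 1)) (q (node hn j 2)) := by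
    refine ⟨feasible_of_mem_poly hn hp j, feasible_of_mem_poly hn hq j, _, _, _, σ, α,
      hind _, hind _, hind _, hσ, hα, hqi _, hqi _, hqi _, fun β hβ hfeas => hmax β hβ ?_⟩
    refine mem_poly_of_eq_off_block hn hp j (fun i hi => ?_) ?_
    · simp [hgσ, hoff i hi]
    · simpa only [Pi.add_apply, Pi.smul_apply, smul_eq_mul, hgσ] using hfeas
  have heq : ∀ i ∈ Finset.univ.erase j,
      level (q (node hn i 0)) (q (node hn i 1)) (q (node hn i 2)) =
        level (p (node hn i 0)) (p (node hn i 1)) (p (node hn i 2)) := fun i hi => by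
    have h (s : Fin 3) : q (node hn i s) = p (node hn i s) := by
      rw [hqi, hoff _ fun t ht => Finset.ne_of_mem_erase hi (node_inj hn ht).1]
      ring
    simp only [h]
  unfold totalLevel
  rw [← Finset.add_sum_erase _ _ (Finset.mem_univ j), ← Finset.add_sum_erase _ _
    (Finset.mem_univ j), Finset.sum_congr rfl heq]
  have := hstep.level_le
  omega

theorem totalLevel_le_of_isCircuitWalk (hn : 3 * k < n) {m : ℕ} {w : Fin (m + 1) → Fin n → ℝ}
    (hw : IsCircuitWalk (edges n) (poly n k) w) (i : Fin (m + 1)) :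
    totalLevel hn (w i) ≤ totalLevel hn (w 0) + i := by
  induction i using Fin.induction with
  | zero => simp
  | succ i ih =>
    obtain ⟨g, α, hg, hα, heq, hmax⟩ := hw.2 i
    have := totalLevel_step_le hn (hw.1 i.castSucc) (hw.1 i.succ) hg hα heq hmax
    simp only [Fin.val_castSucc, Fin.val_succ] at ih ⊢
    omega

theorem zero_mem_poly : (0 : Fin n → ℝ) ∈ poly n k := by
  refine ⟨rfl, fun e _ => ?_⟩
  simp only [Pi.zero_apply, neg_zero, add_zero, cost]
  split_ifs
  · unfold blockCost
    split <;> norm_num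
  · exact le_rfl

theorem target_zero : target n k 0 = 0 := by simp [target, role_zero, blockTarget]

theorem role_le (i : ℕ) : role i ≤ 3 := by
  unfold role
  split_ifs <;> omega

theorem blockTarget_sub_le {a b : ℕ} (ha : a ≤ 3) (hb : b ≤ 3) :
    -blockTarget a + blockTarget b ≤ blockCost a b := by
  interval_cases a <;> interval_cases b <;> norm_num [blockTarget, blockCost]

theorem target_mem_poly : target n k ∈ poly n k := by
  refine ⟨target_zero, ?_⟩
  rintro ⟨a, b⟩ ⟨-, hadj⟩
  by_cases ha : (a : ℕ) ≤ 3 * k <;> by_cases hb : (b : ℕ) ≤ 3 * k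
  · simpa [target, cost, ha, hb] using blockTarget_sub_le (role_le a) (role_le b)
  · have : (a : ℕ) = 0 := by
      simp only at hadj
      omega
    simp [target, cost, hb, this, role_zero, blockTarget]
  · have : (b : ℕ) = 0 := by
      simp only at hadj
      omega
    simp [target, cost, ha, this, role_zero, blockTarget]
  · simp [target, cost, ha, hb]

theorem eq_of_eq_on_nodes (hn : 3 * k < n) {p q : Fin n → ℝ} (hp : p ∈ poly n k)
    (hq : q ∈ poly n k)
    (h : ∀ j, p (node hn j 0) = q (node hn j 0) ∧ p (node hn j 1) = q (node hn j 1) ∧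
      p (node hn j 2) = q (node hn j 2)) : p = q := by
  funext i
  rcases eq_zero_or_node_or_lt hn i with rfl | ⟨j, s, rfl⟩ | hi
  · rw [hp.1, hq.1]
  · fin_cases s
    exacts [(h j).1, (h j).2.1, (h j).2.2]
  · rw [eq_zero_of_mem_poly hp hi, eq_zero_of_mem_poly hq hi]

theorem zero_mem_extremePoints (hn : 3 * k < n) :
    (0 : Fin n → ℝ) ∈ (poly n k).extremePoints ℝ := by
  refine mem_extremePoints_dualPoly zero_mem_poly fun p hp htight =>
    eq_of_eq_on_nodes hn hp zero_mem_poly fun j => ?_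
  have h₁ := htight _ (hub_mem_edges (node_ne_zero hn j 0))
    (by simp [cost_hub_node, blockCost])
  have h₂ := htight _ (node_mem_edges hn j (s := 0) (t := 1) (by decide))
    (by simp [cost_node_node, blockCost])
  have h₃ := htight _ (mem_edges_hub (node_ne_zero hn j 2))
    (by simp [cost_node_hub, blockCost])
  simp [cost_hub_node, cost_node_node, cost_node_hub, blockCost, hp.1] at h₁ h₂ h₃
  simp only [Pi.zero_apply]
  exact ⟨by linarith, by linarith, by linarith⟩

theorem target_mem_extremePoints (hn : 3 * k < n) :
    target n k ∈ (poly n k).extremePoints ℝ := by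
  refine mem_extremePoints_dualPoly target_mem_poly fun p hp htight =>
    eq_of_eq_on_nodes hn hp target_mem_poly fun j => ?_
  have h₁ := htight _ (mem_edges_hub (node_ne_zero hn j 1))
    (by simp [cost_node_hub, target_node, target_zero, blockTarget, blockCost])
  have h₂ := htight _ (node_mem_edges hn j (s := 1) (t := 2) (by decide))
    (by norm_num [cost_node_node, target_node, blockTarget, blockCost])
  have h₃ := htight _ (node_mem_edges hn j (s := 0) (t := 2) (by decide))
    (by norm_num [cost_node_node, target_node, blockTarget, blockCost])
  simp [cost_node_node, cost_node_hub, blockCost, hp.1] at h₁ h₂ h₃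
  simp [target_node, blockTarget]
  exact ⟨by linarith, by linarith, by linarith⟩

end BlockGadget

/-- **Lemma 1 / Lemma 5 (Lower bound on the circuit diameter).**
For every `n ≥ 4` there is a directed graph `G = (V, E)` on `n` nodes (no self-loops,
connected in the underlying undirected graph) with distinguished node `v₀` and costs `c`
such that the circuit diameter of `P(G,c)` is at least `(4/3) n - 4`: there are two extreme
points of `P(G,c)` such that every circuit walk from one to the other has length at least
`(4/3) n - 4`. -/
theorem circuit_diameter_lower_bound :
    ∀ n : ℕ, 4 ≤ n →
      ∃ (E : Set (Fin n × Fin n)) (v₀ : Fin n) (c : Fin n × Fin n → ℝ),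
        (∀ e ∈ E, e.1 ≠ e.2) ∧ UConnected E ∧
        ∃ u ∈ (dualPoly E v₀ c).extremePoints ℝ,
          ∃ v ∈ (dualPoly E v₀ c).extremePoints ℝ,
            ∀ (m : ℕ) (w : Fin (m + 1) → Fin n → ℝ),
              IsCircuitWalk E (dualPoly E v₀ c) w →
                w 0 = u → w (Fin.last m) = v → (4 / 3 : ℝ) * n - 4 ≤ m := by
  intro n hn4
  have : NeZero n := ⟨by omega⟩
  have hn : 3 * ((n - 1) / 3) < n := by omega
  refine ⟨BlockGadget.edges n, 0, BlockGadget.cost n ((n - 1) / 3), fun e he => he.1,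
    BlockGadget.uConnected_edges, 0, BlockGadget.zero_mem_extremePoints hn,
    BlockGadget.target n ((n - 1) / 3), BlockGadget.target_mem_extremePoints hn, ?_⟩
  intro m w hw h0 hlast
  have hle := BlockGadget.totalLevel_le_of_isCircuitWalk hn hw (Fin.last m)
  rw [h0, hlast, BlockGadget.totalLevel_zero, BlockGadget.totalLevel_target, Fin.val_last,
    zero_add] at hle
  have hnat : 4 * n ≤ 3 * m + 12 := by omega
  have hreal : (4 : ℝ) * n ≤ 3 * m + 12 := by exact_mod_cast hnat
  linarith
end

section
/- Let G = (V, E) be a directed graph whose underlying undirected graph is connected, with distinguished node v₀ and costs c : E → ℝ. Let (r,s) ∈ E and suppose there exists a point w ∈ P(G,c) at which (r,s) is tight. Then from every point y ∈ P(G,c) there is a circuit walk of length at most |V| − 1 ending at a point x ∈ P(G,c) at which (r,s) is tight. -/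
open scoped BigOperators

section InsertingEdge

variable {V : Type*} {E : Set (V × V)} {v₀ : V} {c : V × V → ℝ}

/-- The edge `(a, b)` of `E` is tight at `u`. -/
def TightAdj (E : Set (V × V)) (c : V × V → ℝ) (u : V → ℝ) (a b : V) : Prop :=
  (a, b) ∈ E ∧ -u a + u b = c (a, b)

/-- The nodes from which `s` can be reached along edges that are tight at `u`. -/
def tightReach (E : Set (V × V)) (c : V × V → ℝ) (u : V → ℝ) (s : V) : Set V :=
  {a | Relation.ReflTransGen (TightAdj E c u) a s}

/-- The connected component of `r` in the complement of `S`. -/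
def componentOff (E : Set (V × V)) (S : Set V) (r : V) : Set V :=
  {b | Relation.ReflTransGen (fun x y => x ∈ Sᶜ ∧ y ∈ Sᶜ ∧ UAdj E x y) r b}

lemma UAdj.symm {a b : V} (h : UAdj E a b) : UAdj E b a := Or.symm h

lemma reflTransGen_within_symm {S : Set V} {a b : V}
    (h : Relation.ReflTransGen (fun x y => x ∈ S ∧ y ∈ S ∧ UAdj E x y) a b) :
    Relation.ReflTransGen (fun x y => x ∈ S ∧ y ∈ S ∧ UAdj E x y) b a := by
  have : Std.Symm (fun x y => x ∈ S ∧ y ∈ S ∧ UAdj E x y) :=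
    ⟨fun _ _ h => ⟨h.2.1, h.1, h.2.2.symm⟩⟩
  exact Std.Symm.symm _ _ h

lemma setConnected_of_forall_reach {S : Set V} {s : V}
    (h : ∀ a ∈ S, Relation.ReflTransGen (fun x y => x ∈ S ∧ y ∈ S ∧ UAdj E x y) a s) :
    SetConnected E S :=
  fun a ha b hb => (h a ha).trans (reflTransGen_within_symm (h b hb))

lemma mem_tightReach_self (u : V → ℝ) (s : V) : s ∈ tightReach E c u s :=
  Relation.ReflTransGen.refl

lemma mem_tightReach_of_tightAdj {u : V → ℝ} {s a b : V} (hab : TightAdj E c u a b)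
    (hb : b ∈ tightReach E c u s) : a ∈ tightReach E c u s :=
  Relation.ReflTransGen.head hab hb

lemma setConnected_tightReach (u : V → ℝ) (s : V) : SetConnected E (tightReach E c u s) := by
  refine setConnected_of_forall_reach (s := s) fun a ha => ?_
  induction ha using Relation.ReflTransGen.head_induction_on with
  | refl => exact .refl
  | head hab hb ih => exact .head ⟨.head hab hb, hb, Or.inl hab.1⟩ ih

/-- Along a path of edges tight at `u`, the potential difference of `u` is maximal over the
polyhedron. -/
lemma sub_le_of_mem_tightReach {u w : V → ℝ} (hw : w ∈ dualPoly E v₀ c) {a s : V}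
    (h : a ∈ tightReach E c u s) : -w a + w s ≤ -u a + u s := by
  induction h using Relation.ReflTransGen.head_induction_on with
  | refl => simp
  | @head a b hab _ ih =>
    have h₁ : -w a + w b ≤ c (a, b) := hw.2 _ hab.1
    linarith [hab.2]

lemma componentOff_subset_compl {S : Set V} {r : V} (hr : r ∉ S) :
    componentOff E S r ⊆ Sᶜ := by
  intro b hb
  rcases Relation.ReflTransGen.cases_tail hb with rfl | ⟨_, _, h⟩
  · exact hr
  · exact h.2.1

lemma mem_componentOff_of_uAdj {S : Set V} {r a b : V} (hr : r ∉ S)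
    (ha : a ∈ componentOff E S r) (hb : b ∉ S) (hab : UAdj E a b) : b ∈ componentOff E S r :=
  Relation.ReflTransGen.tail ha ⟨componentOff_subset_compl hr ha, hb, hab⟩

lemma setConnected_componentOff (S : Set V) (r : V) : SetConnected E (componentOff E S r) := by
  refine setConnected_of_forall_reach (s := r) fun a ha => reflTransGen_within_symm ?_
  induction ha with
  | refl => exact .refl
  | tail ha hab ih => exact ih.tail ⟨ha, ha.tail hab, hab.2.2⟩

lemma setConnected_compl_componentOff (hconn : UConnected E) {S : Set V}
    (hS : SetConnected E S) {r s : V} (hr : r ∉ S) (hs : s ∈ S) :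
    SetConnected E (componentOff E S r)ᶜ := by
  have hsub : S ⊆ (componentOff E S r)ᶜ := fun x hx h => componentOff_subset_compl hr h hx
  refine setConnected_of_forall_reach (s := s) fun a ha => ?_
  have h := hconn a s
  induction h using Relation.ReflTransGen.head_induction_on with
  | refl => exact .refl
  | @head a b hab _ ih =>
    by_cases hb : b ∈ componentOff E S r
    · have haS : a ∈ S := by
        by_contra haS
        exact ha (mem_componentOff_of_uAdj hr hb haS hab.symm)
      exact Relation.ReflTransGen.mono (fun x y h => ⟨hsub h.1, hsub h.2.1, h.2.2⟩) _ _
        (hS a haS s hs)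
    · exact .head ⟨ha, hb, hab⟩ (ih hb)

/-- A cut of connected sides yields a circuit that fixes `v₀` and, up to a constant, raises the
complement of `R`. -/
lemma exists_isCircuit_eq_indicator_sub (v₀ : V) {R : Set V} (hR : R.Nonempty)
    (hR' : Rᶜ.Nonempty) (hRc : SetConnected E R) (hRc' : SetConnected E Rᶜ) :
    ∃ (g : V → ℝ) (κ : ℝ), IsCircuit E g ∧ g v₀ = 0 ∧ ∀ x, g x = Rᶜ.indicator 1 x - κ := by
  classical
  by_cases h : v₀ ∈ R
  · exact ⟨Rᶜ.indicator 1, 0, ⟨Rᶜ, hR', by simpa using hR, hRc', by simpa using hRc, Or.inl rfl⟩,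
      by simp [h], by simp⟩
  · refine ⟨-R.indicator 1, 1, ⟨R, hR, hR', hRc, hRc', Or.inr rfl⟩, by simp [h], fun x => ?_⟩
    by_cases hx : x ∈ R <;> simp [hx]

/-- If no tight edge leaves `R`, there is a maximal circuit step raising the complement of `R`,
after which some edge leaving `R` is tight. -/
lemma exists_maximal_step [Finite V] {R : Set V} (hRc : SetConnected E R)
    (hRc' : SetConnected E Rᶜ) {r s : V} (hr : r ∈ R) (hs : s ∉ R) (hrs : (r, s) ∈ E)
    {y : V → ℝ} (hy : y ∈ dualPoly E v₀ c)
    (hlt : ∀ a ∈ R, ∀ b ∉ R, ¬ TightAdj E c y a b) :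
    ∃ (g : V → ℝ) (α : ℝ), IsCircuit E g ∧ 0 < α ∧ y + α • g ∈ dualPoly E v₀ c ∧
      (∀ β : ℝ, α < β → y + β • g ∉ dualPoly E v₀ c) ∧
      (∃ a ∈ R, ∃ b ∉ R, TightAdj E c (y + α • g) a b) ∧
      ∀ a ∉ R, ∀ b ∉ R, TightAdj E c y a b → TightAdj E c (y + α • g) a b := by
  classical
  obtain ⟨g, κ, hg, hg₀, hgx⟩ := exists_isCircuit_eq_indicator_sub v₀ ⟨r, hr⟩ ⟨s, hs⟩ hRc hRc'
  obtain ⟨⟨a, b⟩, ⟨habE, ha, hb⟩, hmin⟩ := Set.exists_min_image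
    {e : V × V | e ∈ E ∧ e.1 ∈ R ∧ e.2 ∉ R} (fun e => c e - (-y e.1 + y e.2))
    (Set.toFinite _) ⟨(r, s), hrs, hr, hs⟩
  dsimp only at ha hb hmin
  have hin : ∀ x ∈ R, g x = -κ := fun x hx => by simp [hgx, hx]
  have hout : ∀ x ∉ R, g x = 1 - κ := fun x hx => by simp [hgx, hx]
  have hval : ∀ (β : ℝ) (x : V), (y + β • g) x = y x + β * g x := fun β x => by simp
  have hα : 0 < c (a, b) - (-y a + y b) :=
    sub_pos.2 (lt_of_le_of_ne (hy.2 _ habE) fun h => hlt a ha b hb ⟨habE, h⟩)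
  refine ⟨g, c (a, b) - (-y a + y b), hg, hα, ⟨?_, ?_⟩, ?_, ⟨a, ha, b, hb, habE, ?_⟩, ?_⟩
  · rw [hval, hg₀, hy.1]; ring
  · rintro ⟨p, q⟩ he
    have h := hy.2 _ he
    rw [hval, hval]
    dsimp only at h ⊢
    by_cases hp : p ∈ R <;> by_cases hq : q ∈ R
    · rw [hin p hp, hin q hq]; linarith
    · have := hmin (p, q) ⟨he, hp, hq⟩
      rw [hin p hp, hout q hq]; linarith
    · rw [hout p hp, hin q hq]; linarith
    · rw [hout p hp, hout q hq]; linarith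
  · intro β hβ hmem
    have h := hmem.2 _ habE
    rw [hval, hval, hin a ha, hout b hb] at h
    linarith
  · rw [hval, hval, hin a ha, hout b hb]; ring
  · rintro p hp q hq ⟨he, h⟩
    refine ⟨he, ?_⟩
    rw [hval, hval, hout p hp, hout q hq, ← h]; ring

lemma isCircuitWalk_cons {P : Set (V → ℝ)} {n : ℕ} {ww : Fin (n + 1) → V → ℝ}
    (h : IsCircuitWalk E P ww) {y g : V → ℝ} {α : ℝ} (hy : y ∈ P) (hg : IsCircuit E g)
    (hα : 0 < α) (hww : ww 0 = y + α • g) (hmax : ∀ β : ℝ, α < β → y + β • g ∉ P) :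
    IsCircuitWalk E P (Fin.cons y ww : Fin (n + 1 + 1) → V → ℝ) := by
  refine ⟨Fin.cases hy h.1, Fin.cases ?_ fun i => ?_⟩
  · exact ⟨g, α, hg, hα, hww, hmax⟩
  · simpa only [← Fin.succ_castSucc, Fin.cons_succ] using h.2 i

/-- If `r` does not reach `s` along tight edges, some maximal circuit step strictly enlarges the
set of nodes that do. -/
lemma exists_step_tightReach_ssubset [Finite V] (hconn : UConnected E) {r s : V}
    (hrs : (r, s) ∈ E) {y : V → ℝ} (hy : y ∈ dualPoly E v₀ c) (hr : r ∉ tightReach E c y s) :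
    ∃ (g : V → ℝ) (α : ℝ), IsCircuit E g ∧ 0 < α ∧ y + α • g ∈ dualPoly E v₀ c ∧
      (∀ β : ℝ, α < β → y + β • g ∉ dualPoly E v₀ c) ∧
      tightReach E c y s ⊂ tightReach E c (y + α • g) s := by
  set S := tightReach E c y s
  have hsS : s ∈ S := mem_tightReach_self y s
  have hsub : ∀ x ∈ S, x ∉ componentOff E S r := fun x hx h => componentOff_subset_compl hr h hx
  have hcross : ∀ a ∈ componentOff E S r, ∀ b ∉ componentOff E S r, (a, b) ∈ E → b ∈ S := by
    intro a ha b hb hab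
    by_contra hbS
    exact hb (mem_componentOff_of_uAdj hr ha hbS (Or.inl hab))
  obtain ⟨g, α, hg, hα, hmem, hmax, ⟨a, ha, b, hb, hab⟩, hkeep⟩ :=
    exists_maximal_step (setConnected_componentOff S r)
      (setConnected_compl_componentOff hconn (setConnected_tightReach y s) hr hsS)
      Relation.ReflTransGen.refl (hsub s hsS) hrs hy
      fun a ha b hb hab => hsub a (mem_tightReach_of_tightAdj hab (hcross a ha b hb hab.1)) ha
  have hle : S ⊆ tightReach E c (y + α • g) s := by
    intro x hx
    induction hx using Relation.ReflTransGen.head_induction_on with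
    | refl => exact mem_tightReach_self _ _
    | @head p q hpq hq ih =>
      exact mem_tightReach_of_tightAdj (hkeep p (hsub p (.head hpq hq)) q (hsub q hq) hpq) ih
  refine ⟨g, α, hg, hα, hmem, hmax, hle, fun hge => hsub a (hge ?_) ha⟩
  exact mem_tightReach_of_tightAdj hab (hle (hcross a ha b hb hab.1))

lemma exists_circuitWalk_of_ncard_compl_le [Finite V] (hconn : UConnected E) {r s : V}
    (hrs : (r, s) ∈ E) {w : V → ℝ} (hw : w ∈ dualPoly E v₀ c) (hwt : -w r + w s = c (r, s))
    (m : ℕ) {y : V → ℝ} (hy : y ∈ dualPoly E v₀ c) (hm : (tightReach E c y s)ᶜ.ncard ≤ m) :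
    ∃ n : ℕ, n ≤ m ∧ ∃ ww : Fin (n + 1) → V → ℝ,
      IsCircuitWalk E (dualPoly E v₀ c) ww ∧ ww 0 = y ∧
      -(ww (Fin.last n)) r + (ww (Fin.last n)) s = c (r, s) := by
  induction m using Nat.strong_induction_on generalizing y with
  | _ m ih =>
    by_cases hr : r ∈ tightReach E c y s
    · exact ⟨0, Nat.zero_le _, fun _ => y, ⟨fun _ => hy, fun i => i.elim0⟩, rfl,
        le_antisymm (hy.2 _ hrs) (hwt ▸ sub_le_of_mem_tightReach hw hr)⟩
    · obtain ⟨g, α, hg, hα, hmem, hmax, hlt⟩ := exists_step_tightReach_ssubset hconn hrs hy hr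
      have hcard := Set.ncard_lt_ncard (compl_lt_compl_iff_lt.2 hlt) (Set.toFinite _)
      obtain ⟨n, hn, ww, hwalk, h0, hlast⟩ := ih (m - 1) (by omega) hmem (by omega)
      exact ⟨n + 1, by omega, Fin.cons y ww, isCircuitWalk_cons hwalk hy hg hα h0 hmax, rfl,
        by simpa only [← Fin.succ_last, Fin.cons_succ] using hlast⟩

end InsertingEdge

/-- **Key step in the proof of Theorem 3.**
Let `(r,s) ∈ E` and suppose some point `w ∈ P(G,c)` has the edge `(r,s)` tight. Then from
every point `y ∈ P(G,c)` there is a circuit walk of length at most `|V| - 1` ending at a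
point at which `(r,s)` is tight. -/
theorem circuit_walk_inserting_edge {V : Type*} [Fintype V] (E : Set (V × V))
    (hloop : ∀ e ∈ E, e.1 ≠ e.2) (v₀ : V) (hconn : UConnected E) (c : V × V → ℝ)
    (r s : V) (hrs : (r, s) ∈ E)
    (w : V → ℝ) (hw : w ∈ dualPoly E v₀ c) (hwt : -w r + w s = c (r, s)) :
    ∀ y ∈ dualPoly E v₀ c,
      ∃ n : ℕ, n ≤ Fintype.card V - 1 ∧ ∃ ww : Fin (n + 1) → V → ℝ,
        IsCircuitWalk E (dualPoly E v₀ c) ww ∧ ww 0 = y ∧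
        -(ww (Fin.last n)) r + (ww (Fin.last n)) s = c (r, s) := by
  intro y hy
  refine exists_circuitWalk_of_ncard_compl_le hconn hrs hw hwt _ hy ?_
  have hpos := (Set.ncard_pos (Set.toFinite _)).2 ⟨s, mem_tightReach_self (E := E) (c := c) y s⟩
  have hadd := Set.ncard_add_ncard_compl (tightReach E c y s)
  rw [Nat.card_eq_fintype_card] at hadd
  omega
end
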